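/- Let β⃗ be sub-critical. There exists a constant d > 0 such that for all sufficiently large n and every integer t ≥ n³, there is a coupling of the Glauber chains Z^+(t) (started from the full configuration) and Z^−(t) (started from the empty configuration) satisfying ℙ(Z^+(t) ≠ Z^−(t)) ≤ e^{−d t / n²}; consequently, by monotonicity, for every initial state x, d_TV(law of Z^x(t), π) ≤ e^{−d t / n²} for t ≥ n³. -/

import Mathlib

open Finset MeasureTheory Filter
open scoped ENNReal NNReal

namespace ERGM

/-- The set of edges of the complete graph on `Fin n`: non-diagonal unordered pairs. -/
abbrev EdgeSet (n : ℕ) : Type := {p : Sym2 (Fin n) // ¬ p.IsDiag}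

/-- A configuration (graph on `n` vertices): an assignment of `true/false` to each edge. -/
abbrev Config (n : ℕ) : Type := EdgeSet n → Bool

/-- The value of the configuration `x` on the (unordered) pair `{i,j}`; `false` for `i = j`. -/
noncomputable def edgeVal {n : ℕ} (x : Config n) (i j : Fin n) : Bool :=
  if h : (s(i, j) : Sym2 (Fin n)).IsDiag then false else x ⟨s(i, j), h⟩

/-- Real-valued indicator of presence of the edge `{i,j}` in `x`. -/
noncomputable def edgeInd {n : ℕ} (x : Config n) (i j : Fin n) : ℝ :=
  if edgeVal x i j = true then 1 else 0

open scoped Classical in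
/-- Subgraph counting number `N_G(x)`: the number of copies of `G` in `x` (times the
number of automorphisms), i.e. the sum over injective `ψ` of the product of edge
indicators (each edge indicator is idempotent, so counting ordered adjacent pairs
yields the same value as counting edges). -/
noncomputable def NG {n m : ℕ} (G : SimpleGraph (Fin m)) (x : Config n) : ℝ :=
  ∑ ψ : Fin m ↪ Fin n, ∏ a : Fin m, ∏ b : Fin m,
    if G.Adj a b then edgeInd x (ψ a) (ψ b) else 1

/-- The Hamiltonian `H(x) = Σ_i β_i N_{G_i}(x) / n^{|V_i|-2}`. -/
noncomputable def Hamiltonian {n s : ℕ} (V : Fin s → ℕ)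
    (G : ∀ i, SimpleGraph (Fin (V i))) (β : Fin s → ℝ) (x : Config n) : ℝ :=
  ∑ i, β i * NG (G i) x / (n : ℝ) ^ (V i - 2)

/-- The ERGM probability mass function `π(x) ∝ exp(H(x))`. -/
noncomputable def ergmProb {n s : ℕ} (V : Fin s → ℕ)
    (G : ∀ i, SimpleGraph (Fin (V i))) (β : Fin s → ℝ) (x : Config n) : ℝ :=
  Real.exp (Hamiltonian V G β x) / ∑ y : Config n, Real.exp (Hamiltonian V G β y)

/-- Expectation of `f` with respect to the mass function `w`. -/
noncomputable def expect {n : ℕ} (w : Config n → ℝ) (f : Config n → ℝ) : ℝ :=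
  ∑ x : Config n, w x * f x

open scoped Classical in
/-- Probability of the event `A` with respect to the mass function `w`. -/
noncomputable def prob {n : ℕ} (w : Config n → ℝ) (A : Config n → Prop) : ℝ :=
  ∑ x : Config n, if A x then w x else 0

/-- The number of edges `|E(G)|` of a finite graph. -/
noncomputable def numEdges {m : ℕ} (G : SimpleGraph (Fin m)) : ℕ := G.edgeSet.ncard

/-- `Ψ_β(p) = Σ_i 2 β_i |E_i| p^{|E_i|-1}`. -/
noncomputable def Psi {s : ℕ} (V : Fin s → ℕ) (G : ∀ i, SimpleGraph (Fin (V i)))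
    (β : Fin s → ℝ) (p : ℝ) : ℝ :=
  ∑ i, 2 * β i * (numEdges (G i) : ℝ) * p ^ (numEdges (G i) - 1)

/-- `Φ(u) = e^u / (1 + e^u)`. -/
noncomputable def Phi (u : ℝ) : ℝ := Real.exp u / (1 + Real.exp u)

/-- `φ_β(p) = Φ(Ψ_β(p))`. -/
noncomputable def phiFn {s : ℕ} (V : Fin s → ℕ) (G : ∀ i, SimpleGraph (Fin (V i)))
    (β : Fin s → ℝ) : ℝ → ℝ := fun p => Phi (Psi V G β p)

/-- `β` is sub-critical (high temperature) with fixed point `p`: `p` is the unique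
solution of `φ_β(p) = p` and it satisfies `φ_β'(p) < 1`. -/
def Subcritical {s : ℕ} (V : Fin s → ℕ) (G : ∀ i, SimpleGraph (Fin (V i)))
    (β : Fin s → ℝ) (p : ℝ) : Prop :=
  phiFn V G β p = p ∧ (∀ q : ℝ, phiFn V G β q = q → q = p) ∧
    deriv (phiFn V G β) p < 1

/-- The discrete derivative `∂_e H(x) = H(x_{e+}) - H(x_{e-})`. -/
noncomputable def dHam {n s : ℕ} (V : Fin s → ℕ) (G : ∀ i, SimpleGraph (Fin (V i)))
    (β : Fin s → ℝ) (e : EdgeSet n) (x : Config n) : ℝ :=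
  Hamiltonian V G β (Function.update x e true) - Hamiltonian V G β (Function.update x e false)

/-- Real-valued indicator `X_e` of presence of edge `e`. -/
noncomputable def edgeX {n : ℕ} (e : EdgeSet n) (x : Config n) : ℝ := if x e = true then 1 else 0

/-- Two edges of `K_n` share a vertex. -/
def ShareVertex {n : ℕ} (e f : EdgeSet n) : Prop := ∃ v : Fin n, v ∈ e.1 ∧ v ∈ f.1


instance (n : ℕ) : MeasurableSpace (EdgeSet n) := ⊤

open scoped Classical in
/-- One step of the grand coupling driven by the seed `ω = (I, U)`: the coordinate `I`
of `x` is set to `1` iff `U ≤ Φ(∂_I H(x))`. -/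
noncomputable def gcStep {n s : ℕ} (V : Fin s → ℕ) (G : ∀ i, SimpleGraph (Fin (V i)))
    (β : Fin s → ℝ) (ω : EdgeSet n × ℝ) (x : Config n) : Config n :=
  Function.update x ω.1 (if ω.2 ≤ Phi (dHam V G β ω.1 x) then true else false)

/-- `t` steps of the grand coupling driven by the seeds `ω : Fin t → EdgeSet n × ℝ`. -/
noncomputable def gcRun {n s : ℕ} (V : Fin s → ℕ) (G : ∀ i, SimpleGraph (Fin (V i)))
    (β : Fin s → ℝ) : (t : ℕ) → (Fin t → EdgeSet n × ℝ) → Config n → Config n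
  | 0, _, x => x
  | t + 1, ω, x =>
      gcStep V G β (ω (Fin.last t)) (gcRun V G β t (fun i => ω i.castSucc) x)

/-- The law of one seed of the grand coupling: a uniformly chosen edge `I` together
with an independent uniform variable `U` on `[0,1]`. -/
noncomputable def seed (n : ℕ) : Measure (EdgeSet n × ℝ) :=
  ((Fintype.card (EdgeSet n) : ℝ≥0∞)⁻¹ • (Measure.count : Measure (EdgeSet n))).prod
    (volume.restrict (Set.Ioc (0 : ℝ) 1))

/-- The law of `t` independent seeds of the grand coupling. -/
noncomputable def seeds (n t : ℕ) : Measure (Fin t → EdgeSet n × ℝ) :=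
  Measure.pi fun _ => seed n

/-- The total variation distance between two measures. -/
noncomputable def dTVmeas {α : Type*} [MeasurableSpace α] (μ ν : Measure α) : ℝ :=
  ⨆ A : Set α, |(μ A).toReal - (ν A).toReal|

/-- The law at time `t` of the Glauber dynamics started from the configuration `x`. -/
noncomputable def lawFrom {n s : ℕ} (V : Fin s → ℕ) (G : ∀ i, SimpleGraph (Fin (V i)))
    (β : Fin s → ℝ) (t : ℕ) (x : Config n) : Measure (Config n) :=
  Measure.map (fun ω : Fin t → EdgeSet n × ℝ => gcRun V G β t ω x) (seeds n t)

/-- The ERGM distribution as a measure on configurations. -/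
noncomputable def ergmMeasure (n : ℕ) {s : ℕ} (V : Fin s → ℕ)
    (G : ∀ i, SimpleGraph (Fin (V i))) (β : Fin s → ℝ) : Measure (Config n) :=
  Measure.count.withDensity fun x => ENNReal.ofReal (ergmProb V G β x)

section Dynamics

variable {E : Type*} [Fintype E] [DecidableEq E]

/-- The one-step transition operator of the heat-bath dynamics in which a uniformly chosen
coordinate `e` is set to `true` with probability `c e x`. -/
noncomputable def glauber (c : E → (E → Bool) → ℝ) :
    Module.End ℝ ((E → Bool) → ℝ) where
  toFun f x := (Fintype.card E : ℝ)⁻¹ * ∑ e, (c e x * f (Function.update x e true)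
    + (1 - c e x) * f (Function.update x e false))
  map_add' f g := by
    funext x
    simp only [Pi.add_apply]
    rw [← mul_add, ← Finset.sum_add_distrib]
    congr 1
    exact Finset.sum_congr rfl fun e _ => by ring
  map_smul' r f := by
    funext x
    simp only [Pi.smul_apply, smul_eq_mul, RingHom.id_apply]
    rw [mul_left_comm, Finset.mul_sum (a := r)]
    congr 1
    exact Finset.sum_congr rfl fun e _ => by ring

lemma glauber_apply (c : E → (E → Bool) → ℝ) (f : (E → Bool) → ℝ) (x : E → Bool) :
    glauber c f x = (Fintype.card E : ℝ)⁻¹ * ∑ e, (c e x * f (Function.update x e true)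
      + (1 - c e x) * f (Function.update x e false)) := rfl

lemma glauber_mono {c : E → (E → Bool) → ℝ} (hc : ∀ e x, c e x ∈ Set.Icc (0 : ℝ) 1) :
    Monotone (glauber c) := by
  intro f g h x
  rw [glauber_apply, glauber_apply]
  gcongr with e
  · exact (hc e x).1
  · exact h _
  · linarith [(hc e x).2]
  · exact h _

lemma glauber_const [Nonempty E] (c : E → (E → Bool) → ℝ) (r : ℝ) :
    glauber c (fun _ => r) = fun _ => r := by
  funext x
  have : (Fintype.card E : ℝ) ≠ 0 := by exact_mod_cast Fintype.card_ne_zero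
  simp only [glauber_apply]
  rw [Finset.sum_congr rfl (fun e _ => show c e x * r + (1 - c e x) * r = r by ring)]
  simp [this]

lemma glauber_pow_mono {c : E → (E → Bool) → ℝ} (hc : ∀ e x, c e x ∈ Set.Icc (0 : ℝ) 1)
    (t : ℕ) : Monotone ((glauber c) ^ t) := by
  induction t with
  | zero => intro f g h; simpa using h
  | succ t ih =>
    intro f g h
    rw [pow_succ, Module.End.mul_apply, Module.End.mul_apply]
    exact ih (glauber_mono hc h)

lemma glauber_pow_const [Nonempty E] (c : E → (E → Bool) → ℝ) (r : ℝ) (t : ℕ) :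
    ((glauber c) ^ t) (fun _ => r) = fun _ => r := by
  induction t with
  | zero => simp
  | succ t ih => rw [pow_succ, Module.End.mul_apply, glauber_const, ih]

lemma glauber_pow_le_of_le [Nonempty E] {c : E → (E → Bool) → ℝ}
    (hc : ∀ e x, c e x ∈ Set.Icc (0 : ℝ) 1) (t : ℕ) {f : (E → Bool) → ℝ} {r : ℝ}
    (h : ∀ x, f x ≤ r) (x : E → Bool) : ((glauber c) ^ t) f x ≤ r := by
  have := glauber_pow_mono hc t (show f ≤ fun _ => r from h) x
  rwa [glauber_pow_const] at this

lemma le_glauber_pow_of_le [Nonempty E] {c : E → (E → Bool) → ℝ}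
    (hc : ∀ e x, c e x ∈ Set.Icc (0 : ℝ) 1) (t : ℕ) {f : (E → Bool) → ℝ} {r : ℝ}
    (h : ∀ x, r ≤ f x) (x : E → Bool) : r ≤ ((glauber c) ^ t) f x := by
  have := glauber_pow_mono hc t (show (fun _ => r) ≤ f from h) x
  rwa [glauber_pow_const] at this

/-- Changing one coordinate at a time, a function whose discrete derivatives are bounded by `δ`
oscillates by at most `δ` times the number of coordinates. -/
lemma abs_sub_le_card_mul {g : (E → Bool) → ℝ} {δ : ℝ}
    (h : ∀ e x, |g (Function.update x e true) - g (Function.update x e false)| ≤ δ)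
    (x y : E → Bool) : |g x - g y| ≤ Fintype.card E * δ := by
  have hstep : ∀ e x b, |g (Function.update x e b) - g x| ≤ δ := by
    intro e x b
    have h0 : 0 ≤ δ := (abs_nonneg _).trans (h e x)
    have hx : g x = g (Function.update x e (x e)) := by rw [Function.update_eq_self]
    rw [hx]
    generalize x e = b'
    cases b <;> cases b'
    · simpa using h0
    · rw [abs_sub_comm]; exact h e x
    · exact h e x
    · simpa using h0
  have key : ∀ s : Finset E, |g (s.piecewise x y) - g y| ≤ s.card * δ := by
    intro s
    induction s using Finset.induction_on with
    | empty => simp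
    | insert a s ha ih =>
      rw [Finset.piecewise_insert, Finset.card_insert_of_notMem ha]
      push_cast
      calc _ ≤ |g (Function.update (s.piecewise x y) a (x a)) - g (s.piecewise x y)|
            + |g (s.piecewise x y) - g y| := abs_sub_le _ _ _
        _ ≤ δ + s.card * δ := add_le_add (hstep _ _ _) ih
        _ = _ := by ring
  simpa using key Finset.univ

/-- With constant rates, one step contracts the discrete derivatives. -/
lemma glauber_const_rate_deriv_le {q : ℝ} (hq : q ∈ Set.Icc (0 : ℝ) 1)
    {g : (E → Bool) → ℝ} {δ : ℝ}
    (h : ∀ e x, |g (Function.update x e true) - g (Function.update x e false)| ≤ δ)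
    (e : E) (x : E → Bool) :
    |glauber (fun _ _ => q) g (Function.update x e true)
      - glauber (fun _ _ => q) g (Function.update x e false)|
      ≤ (1 - (Fintype.card E : ℝ)⁻¹) * δ := by
  have : Nonempty E := ⟨e⟩
  have hM : (0 : ℝ) < Fintype.card E := by exact_mod_cast Fintype.card_pos
  have hterm : ∀ f : E, |(q * g (Function.update (Function.update x e true) f true)
      + (1 - q) * g (Function.update (Function.update x e true) f false))
      - (q * g (Function.update (Function.update x e false) f true)
      + (1 - q) * g (Function.update (Function.update x e false) f false))|
      ≤ if f = e then 0 else δ := by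
    intro f
    split_ifs with hf
    · subst hf; simp
    · rw [Function.update_comm (Ne.symm hf), Function.update_comm (Ne.symm hf),
        Function.update_comm (Ne.symm hf), Function.update_comm (Ne.symm hf)]
      have h1 := abs_le.1 (h e (Function.update x f true))
      have h2 := abs_le.1 (h e (Function.update x f false))
      have hq0 := hq.1
      have hq1 : 0 ≤ 1 - q := by linarith [hq.2]
      rw [abs_le]
      constructor <;>
      nlinarith [mul_le_mul_of_nonneg_left h1.1 hq0, mul_le_mul_of_nonneg_left h2.1 hq1,
        mul_le_mul_of_nonneg_left h1.2 hq0, mul_le_mul_of_nonneg_left h2.2 hq1]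
  rw [glauber_apply, glauber_apply, ← mul_sub, ← Finset.sum_sub_distrib, abs_mul,
    abs_of_pos (inv_pos.2 hM)]
  have hsum : (∑ f : E, if f = e then 0 else δ) = (Fintype.card E - 1) * δ := by
    have : ∀ f : E, (if f = e then 0 else δ) = δ - if f = e then δ else 0 := by
      intro f; split_ifs <;> simp
    rw [Finset.sum_congr rfl fun f _ => this f, Finset.sum_sub_distrib]
    simp; ring
  calc _ ≤ (Fintype.card E : ℝ)⁻¹ * ((Fintype.card E - 1) * δ) := by
        gcongr
        rw [← hsum]
        exact (Finset.abs_sum_le_sum_abs _ _).trans (Finset.sum_le_sum fun f _ => hterm f)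
    _ = _ := by field_simp

lemma glauber_const_rate_pow_deriv_le {q : ℝ} (hq : q ∈ Set.Icc (0 : ℝ) 1)
    (t : ℕ) {g : (E → Bool) → ℝ} {δ : ℝ}
    (h : ∀ e x, |g (Function.update x e true) - g (Function.update x e false)| ≤ δ)
    (e : E) (x : E → Bool) :
    |((glauber (fun _ _ => q)) ^ t) g (Function.update x e true)
      - ((glauber (fun _ _ => q)) ^ t) g (Function.update x e false)|
      ≤ (1 - (Fintype.card E : ℝ)⁻¹) ^ t * δ := by
  induction t generalizing g δ with
  | zero => simpa using h e x
  | succ t ih =>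
    rw [pow_succ, Module.End.mul_apply]
    refine (ih (glauber_const_rate_deriv_le hq h)).trans_eq ?_
    ring

/-! ### Stationary weights -/

lemma sum_update_true_add_update_false (e : E) (g : (E → Bool) → ℝ) :
    ∑ x : E → Bool, (g (Function.update x e true) + g (Function.update x e false))
      = 2 * ∑ x, g x := by
  let flip : (E → Bool) → (E → Bool) := fun x => Function.update x e (!x e)
  have hinv : Function.Involutive flip := by
    intro x
    simp [flip]
  have h1 : ∀ x, g (Function.update x e true) + g (Function.update x e false)
      = g x + g (flip x) := by
    intro x
    have hx : g x = g (Function.update x e (x e)) := by rw [Function.update_eq_self]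
    rw [hx]
    simp only [flip]
    cases x e <;> simp [add_comm]
  rw [Finset.sum_congr rfl fun x _ => h1 x, Finset.sum_add_distrib,
    (hinv.bijective).sum_comp g]
  ring

/-- Resampling coordinate `e` preserves a weight whose conditional probabilities are the rates. -/
lemma sum_mul_resample {w : (E → Bool) → ℝ} {c : (E → Bool) → ℝ} (e : E)
    (hce : ∀ x b, c (Function.update x e b) = c x)
    (hw : ∀ x, c x * (w (Function.update x e true) + w (Function.update x e false))
      = w (Function.update x e true)) (f : (E → Bool) → ℝ) :
    ∑ x, w x * (c x * f (Function.update x e true) + (1 - c x) * f (Function.update x e false))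
      = ∑ x, w x * f x := by
  have h2 : (2 : ℝ) ≠ 0 := two_ne_zero
  refine mul_left_cancel₀ h2 ?_
  rw [← sum_update_true_add_update_false e, ← sum_update_true_add_update_false e]
  refine Finset.sum_congr rfl fun x _ => ?_
  simp only [hce, Function.update_idem]
  linear_combination (f (Function.update x e true) - f (Function.update x e false)) * hw x

lemma sum_mul_glauber [Nonempty E] {w : (E → Bool) → ℝ} {c : E → (E → Bool) → ℝ}
    (hce : ∀ e x b, c e (Function.update x e b) = c e x)
    (hw : ∀ e x, c e x * (w (Function.update x e true) + w (Function.update x e false))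
      = w (Function.update x e true)) (f : (E → Bool) → ℝ) :
    ∑ x, w x * glauber c f x = ∑ x, w x * f x := by
  have hM : (Fintype.card E : ℝ) ≠ 0 := by exact_mod_cast Fintype.card_ne_zero
  have : ∀ x, w x * glauber c f x = (Fintype.card E : ℝ)⁻¹ * ∑ e, w x *
      (c e x * f (Function.update x e true) + (1 - c e x) * f (Function.update x e false)) := by
    intro x
    rw [glauber_apply, ← Finset.mul_sum]
    ring
  rw [Finset.sum_congr rfl fun x _ => this x, ← Finset.mul_sum, Finset.sum_comm,
    Finset.sum_congr rfl fun e _ => sum_mul_resample e (hce e) (hw e) f]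
  simp [hM]

lemma sum_mul_glauber_pow [Nonempty E] {w : (E → Bool) → ℝ} {c : E → (E → Bool) → ℝ}
    (hce : ∀ e x b, c e (Function.update x e b) = c e x)
    (hw : ∀ e x, c e x * (w (Function.update x e true) + w (Function.update x e false))
      = w (Function.update x e true)) (t : ℕ) (f : (E → Bool) → ℝ) :
    ∑ x, w x * ((glauber c) ^ t) f x = ∑ x, w x * f x := by
  induction t generalizing f with
  | zero => simp
  | succ t ih => rw [pow_succ, Module.End.mul_apply, ih, sum_mul_glauber hce hw]

/-! ### The product Bernoulli weight -/

/-- The product Bernoulli weight with parameter `q`. -/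
noncomputable def bern (q : ℝ) (x : E → Bool) : ℝ := ∏ e, if x e = true then q else 1 - q

/-- Expectation under the product Bernoulli weight. -/
noncomputable def bernMean (q : ℝ) (f : (E → Bool) → ℝ) : ℝ := ∑ x, bern q x * f x

lemma bern_nonneg {q : ℝ} (hq : q ∈ Set.Icc (0 : ℝ) 1) (x : E → Bool) : 0 ≤ bern q x := by
  refine Finset.prod_nonneg fun e _ => ?_
  split_ifs
  · exact hq.1
  · linarith [hq.2]

lemma bern_update (q : ℝ) (e : E) (x : E → Bool) (b : Bool) :
    bern q (Function.update x e b)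
      = (if b = true then q else 1 - q) * ∏ f ∈ Finset.univ.erase e,
        if x f = true then q else 1 - q := by
  rw [bern, ← Finset.mul_prod_erase _ _ (Finset.mem_univ e)]
  congr 1
  · simp
  · refine Finset.prod_congr rfl fun f hf => ?_
    rw [Function.update_of_ne (Finset.ne_of_mem_erase hf)]

lemma bern_conditional (q : ℝ) (e : E) (x : E → Bool) :
    q * (bern q (Function.update x e true) + bern q (Function.update x e false))
      = bern q (Function.update x e true) := by
  rw [bern_update, bern_update, if_pos rfl, if_neg Bool.false_ne_true]
  ring

/-- The indicator that all coordinates in `R` are `true`. -/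
noncomputable def allTrue (R : Finset E) (x : E → Bool) : ℝ := if ∀ e ∈ R, x e = true then 1 else 0

lemma bernMean_allTrue (q : ℝ) (R : Finset E) : bernMean q (allTrue R) = q ^ R.card := by
  have h : ∀ x : E → Bool, bern q x * allTrue R x
      = ∏ e, ((if x e = true then q else 1 - q) * if e ∈ R ∧ x e = false then 0 else 1) := by
    intro x
    rw [Finset.prod_mul_distrib, ← bern]
    congr 1
    rw [allTrue]
    split_ifs with hx
    · symm
      refine Finset.prod_eq_one fun e _ => ?_
      rw [if_neg]
      rintro ⟨he, hf⟩
      simp [hx e he] at hf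
    · push Not at hx
      obtain ⟨e, he, hf⟩ := hx
      symm
      refine Finset.prod_eq_zero (Finset.mem_univ e) ?_
      rw [if_pos ⟨he, by simpa using hf⟩]
  rw [bernMean, Finset.sum_congr rfl fun x _ => h x]
  rw [← Fintype.prod_sum (fun (e : E) (b : Bool) =>
    (if b = true then q else 1 - q) * if e ∈ R ∧ b = false then 0 else 1)]
  have : ∀ e : E, ∑ b : Bool, ((if b = true then q else 1 - q) * if e ∈ R ∧ b = false then 0 else 1)
      = if e ∈ R then q else 1 := by
    intro e
    by_cases he : e ∈ R <;> simp [he]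
  rw [Finset.prod_congr rfl fun e _ => this e]
  simp [Finset.prod_ite_mem]

lemma sum_bern (q : ℝ) : ∑ x : E → Bool, bern q x = 1 := by
  have := bernMean_allTrue (E := E) q ∅
  simpa [bernMean, allTrue] using this

lemma bernMean_mono {q : ℝ} (hq : q ∈ Set.Icc (0 : ℝ) 1) {f g : (E → Bool) → ℝ}
    (h : ∀ x, f x ≤ g x) : bernMean q f ≤ bernMean q g :=
  Finset.sum_le_sum fun x _ => mul_le_mul_of_nonneg_left (h x) (bern_nonneg hq x)

lemma bernMean_mul_const (q r : ℝ) (f : (E → Bool) → ℝ) :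
    bernMean q (fun x => f x * r) = bernMean q f * r := by
  rw [bernMean, bernMean, Finset.sum_mul]
  exact Finset.sum_congr rfl fun x _ => by ring

lemma bernMean_sum {J : Type*} (s : Finset J) (q : ℝ) (f : J → (E → Bool) → ℝ) :
    bernMean q (fun x => ∑ j ∈ s, f j x) = ∑ j ∈ s, bernMean q (f j) := by
  simp only [bernMean, Finset.mul_sum]
  exact Finset.sum_comm

lemma bernMean_const (q r : ℝ) : bernMean q (fun _ : E → Bool => r) = r := by
  rw [bernMean, ← Finset.sum_mul, sum_bern, one_mul]

/-- The dynamics with constant rate `q`, run for `t` steps from any state, is close to the product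
Bernoulli weight. -/
lemma glauber_const_rate_pow_le [Nonempty E] {q : ℝ} (hq : q ∈ Set.Icc (0 : ℝ) 1) (t : ℕ)
    {f : (E → Bool) → ℝ} (hf : ∀ x, f x ∈ Set.Icc (0 : ℝ) 1) (x : E → Bool) :
    ((glauber (fun _ _ => q)) ^ t) f x
      ≤ bernMean q f + Fintype.card E * (1 - (Fintype.card E : ℝ)⁻¹) ^ t := by
  have hosc : ∀ e x, |f (Function.update x e true) - f (Function.update x e false)| ≤ 1 := by
    intro e x
    have h1 := hf (Function.update x e true)
    have h2 := hf (Function.update x e false)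
    rw [abs_le]
    constructor <;> linarith [h1.1, h1.2, h2.1, h2.2]
  set g := ((glauber (fun (_ : E) (_ : E → Bool) => q)) ^ t) f with hg
  have hmean : bernMean q g = bernMean q f :=
    sum_mul_glauber_pow (fun _ _ _ => rfl) (fun e x => bern_conditional q e x) t f
  rw [← hmean]
  have hle : ∀ y, g x - Fintype.card E * (1 - (Fintype.card E : ℝ)⁻¹) ^ t ≤ g y := by
    intro y
    have := abs_le.1 (abs_sub_le_card_mul (glauber_const_rate_pow_deriv_le hq t hosc) x y)
    linarith [this.2]
  have := bernMean_mono hq hle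
  rw [bernMean_const] at this
  linarith

/-! ### Concentration -/

lemma hoeffding_two_point {q : ℝ} (hq : q ∈ Set.Icc (0 : ℝ) 1) {a b k : ℝ} (hk : |a - b| ≤ k) :
    q * Real.exp a + (1 - q) * Real.exp b
      ≤ Real.exp (q * a + (1 - q) * b) * Real.exp (k ^ 2 / 2) := by
  obtain ⟨hq0, hq1⟩ := hq
  have hk0 : 0 ≤ k := (abs_nonneg _).trans hk
  rcases hk0.eq_or_lt with rfl | hkpos
  · have : a = b := by
      have := abs_nonpos_iff.1 hk
      linarith
    subst this
    have : q * a + (1 - q) * a = a := by ring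
    rw [this]
    simp
    linarith
  have hconv : ∀ v, |v| ≤ k → Real.exp v ≤ Real.cosh k + v / k * Real.sinh k := by
    intro v hv
    obtain ⟨hv1, hv2⟩ := abs_le.1 hv
    have := convexOn_exp.2 (Set.mem_univ k) (Set.mem_univ (-k))
      (show 0 ≤ (k + v) / (2 * k) by apply div_nonneg <;> linarith)
      (show 0 ≤ (k - v) / (2 * k) by apply div_nonneg <;> linarith)
      (by field_simp; ring)
    have harg : ((k + v) / (2 * k)) • k + ((k - v) / (2 * k)) • (-k) = v := by
      simp only [smul_eq_mul]; field_simp; ring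
    rw [harg] at this
    refine this.trans_eq ?_
    rw [Real.cosh_eq, Real.sinh_eq]
    simp only [smul_eq_mul]
    field_simp
    ring
  have hv1 : |(1 - q) * (a - b)| ≤ k := by
    rw [abs_mul, abs_of_nonneg (by linarith : 0 ≤ 1 - q)]
    nlinarith [abs_nonneg (a - b)]
  have hv2 : |(-q) * (a - b)| ≤ k := by
    rw [abs_mul, abs_neg, abs_of_nonneg hq0]
    nlinarith [abs_nonneg (a - b)]
  have e1 : Real.exp a = Real.exp (q * a + (1 - q) * b) * Real.exp ((1 - q) * (a - b)) := by
    rw [← Real.exp_add]; congr 1; ring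
  have e2 : Real.exp b = Real.exp (q * a + (1 - q) * b) * Real.exp ((-q) * (a - b)) := by
    rw [← Real.exp_add]; congr 1; ring
  have hcosh : q * Real.exp ((1 - q) * (a - b)) + (1 - q) * Real.exp ((-q) * (a - b))
      ≤ Real.cosh k := by
    have h1 := mul_le_mul_of_nonneg_left (hconv _ hv1) hq0
    have h2 := mul_le_mul_of_nonneg_left (hconv _ hv2) (by linarith : 0 ≤ 1 - q)
    refine (add_le_add h1 h2).trans_eq ?_
    field_simp
    ring
  calc q * Real.exp a + (1 - q) * Real.exp b
      = Real.exp (q * a + (1 - q) * b) * (q * Real.exp ((1 - q) * (a - b))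
        + (1 - q) * Real.exp ((-q) * (a - b))) := by
        rw [mul_add]; nth_rewrite 1 [e1]; nth_rewrite 1 [e2]; ring
    _ ≤ _ := by
        gcongr
        exact hcosh.trans (Real.cosh_le_exp_half_sq k)

/-- The bounded-differences exponential moment bound for product Bernoulli weights. -/
lemma bernMean_exp_le {q : ℝ} (hq : q ∈ Set.Icc (0 : ℝ) 1) (F : (E → Bool) → ℝ) (k : E → ℝ)
    (hF : ∀ e x, |F (Function.update x e true) - F (Function.update x e false)| ≤ k e) :
    bernMean q (fun x => Real.exp (F x))
      ≤ Real.exp (bernMean q F) * Real.exp (∑ e, k e ^ 2 / 2) := by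
  have hresample : ∀ (e : E) (f : (E → Bool) → ℝ),
      bernMean q (fun x => q * f (Function.update x e true)
        + (1 - q) * f (Function.update x e false)) = bernMean q f := fun e f =>
    sum_mul_resample (c := fun _ => q) e (fun _ _ => rfl) (bern_conditional q e) f
  have key : ∀ s : Finset E, ∃ F' : (E → Bool) → ℝ,
      (∀ e ∈ s, ∀ x, F' (Function.update x e true) = F' (Function.update x e false)) ∧
      (∀ e x, |F' (Function.update x e true) - F' (Function.update x e false)| ≤ k e) ∧
      bernMean q F' = bernMean q F ∧
      bernMean q (fun x => Real.exp (F x))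
        ≤ bernMean q (fun x => Real.exp (F' x)) * Real.exp (∑ e ∈ s, k e ^ 2 / 2) := by
    intro s
    induction s using Finset.induction_on with
    | empty => exact ⟨F, by simp, hF, rfl, by simp⟩
    | insert a s ha ih =>
      obtain ⟨F', h1, h2, h3, h4⟩ := ih
      refine ⟨fun x => q * F' (Function.update x a true) + (1 - q) * F' (Function.update x a false),
        ?_, ?_, ?_, ?_⟩
      · intro e he x
        by_cases hea : e = a
        · subst hea; simp
        · have hes : e ∈ s := Finset.mem_of_mem_insert_of_ne he hea
          simp only [Function.update_comm hea]
          rw [h1 e hes, h1 e hes]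
      · intro e x
        by_cases hea : e = a
        · subst hea; simpa using (abs_nonneg _).trans (h2 e x)
        · simp only [Function.update_comm hea]
          have g1 := abs_le.1 (h2 e (Function.update x a true))
          have g2 := abs_le.1 (h2 e (Function.update x a false))
          have hq0 := hq.1
          have hq1 : 0 ≤ 1 - q := by linarith [hq.2]
          rw [abs_le]
          constructor <;>
          nlinarith [mul_le_mul_of_nonneg_left g1.1 hq0, mul_le_mul_of_nonneg_left g2.1 hq1,
            mul_le_mul_of_nonneg_left g1.2 hq0, mul_le_mul_of_nonneg_left g2.2 hq1]
      · rw [hresample, h3]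
      · refine h4.trans ?_
        rw [Finset.sum_insert ha, Real.exp_add, ← mul_assoc]
        gcongr
        rw [← hresample a, ← bernMean_mul_const]
        exact bernMean_mono hq fun x => hoeffding_two_point hq (h2 a x)
  obtain ⟨F', h1, -, h3, h4⟩ := key Finset.univ
  have hconst : ∀ x y, F' x = F' y := by
    intro x y
    have := abs_sub_le_card_mul (g := F') (δ := 0)
      (fun e x => by rw [h1 e (Finset.mem_univ e), sub_self, abs_zero]) x y
    simpa [sub_eq_zero] using this
  have hF' : ∀ x, F' x = bernMean q F := by
    intro x
    rw [← h3, show F' = fun _ => F' x from funext fun y => hconst y x, bernMean_const]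
  simpa only [hF', bernMean_const] using h4

/-- Bounded-differences upper tail for product Bernoulli weights. -/
lemma bernMean_tail_le {q : ℝ} (hq : q ∈ Set.Icc (0 : ℝ) 1) (F : (E → Bool) → ℝ) (k : E → ℝ)
    (hF : ∀ e x, |F (Function.update x e true) - F (Function.update x e false)| ≤ k e)
    {m ε lam : ℝ} (hlam : 0 ≤ lam) (hm : bernMean q F + ε ≤ m) :
    bernMean q (fun x => if m < F x then 1 else 0)
      ≤ Real.exp (-(lam * ε) + lam ^ 2 * (∑ e, k e ^ 2) / 2) := by
  have h1 : bernMean q (fun x => if m < F x then 1 else 0)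
      ≤ bernMean q (fun x => Real.exp (F x * lam) * Real.exp (-(lam * m))) := by
    refine bernMean_mono hq fun x => ?_
    rw [← Real.exp_add]
    split_ifs with h
    · rw [Real.one_le_exp_iff]
      nlinarith
    · positivity
  have h2 := bernMean_exp_le hq (fun x => F x * lam) (fun e => k e * lam) (by
    intro e x
    rw [← sub_mul, abs_mul, abs_of_nonneg hlam]
    exact mul_le_mul_of_nonneg_right (hF e x) hlam)
  rw [bernMean_mul_const] at h1 h2
  refine h1.trans ((mul_le_mul_of_nonneg_right h2 (Real.exp_nonneg _)).trans ?_)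
  rw [← Real.exp_add, ← Real.exp_add]
  refine Real.exp_le_exp.2 ?_
  have : ∑ e, (k e * lam) ^ 2 / 2 = lam ^ 2 * (∑ e, k e ^ 2) / 2 := by
    rw [Finset.mul_sum, Finset.sum_div]
    exact Finset.sum_congr rfl fun e _ => by ring
  rw [this]
  nlinarith

/-! ### Comparison with constant rates -/

/-- `f` is monotone if `σ > 0` and antitone if `σ < 0`. -/
def SignedMono (σ : ℝ) (f : (E → Bool) → ℝ) : Prop :=
  ∀ e x, 0 ≤ σ * (f (Function.update x e true) - f (Function.update x e false))

lemma SignedMono.glauber_const_rate {σ q : ℝ} (hq : q ∈ Set.Icc (0 : ℝ) 1)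
    {f : (E → Bool) → ℝ} (hf : SignedMono σ f) : SignedMono σ (glauber (fun _ _ => q) f) := by
  intro e x
  rw [glauber_apply, glauber_apply, ← mul_sub, ← Finset.sum_sub_distrib, mul_left_comm,
    Finset.mul_sum]
  refine mul_nonneg (by positivity) (Finset.sum_nonneg fun g _ => ?_)
  by_cases hg : g = e
  · subst hg; simp
  · rw [Function.update_comm (Ne.symm hg), Function.update_comm (Ne.symm hg),
      Function.update_comm (Ne.symm hg), Function.update_comm (Ne.symm hg)]
    have h1 := mul_nonneg hq.1 (hf e (Function.update x g true))
    have h2 := mul_nonneg (show 0 ≤ 1 - q by linarith [hq.2]) (hf e (Function.update x g false))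
    nlinarith

/-- While the rates are on the correct side of `q` outside the event `B`, the dynamics is dominated
by the one with constant rate `q`. -/
lemma glauber_pow_add_le [Nonempty E] {c : E → (E → Bool) → ℝ}
    (hc : ∀ e x, c e x ∈ Set.Icc (0 : ℝ) 1) {σ q : ℝ} (hσ : σ = 1 ∨ σ = -1)
    (hq : q ∈ Set.Icc (0 : ℝ) 1)
    {B : (E → Bool) → ℝ} (hB0 : ∀ x, 0 ≤ B x)
    (hB : ∀ x, B x < 1 → ∀ e, σ * (c e x - q) ≤ 0) {a : ℕ} {η : ℝ} (T : ℕ)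
    (hη : ∀ s, a ≤ s → s ≤ a + T → ∀ x, ((glauber c) ^ s) B x ≤ η)
    {f : (E → Bool) → ℝ} (hf : ∀ x, f x ∈ Set.Icc (0 : ℝ) 1) (hfσ : SignedMono σ f)
    (x : E → Bool) :
    ((glauber c) ^ (a + T)) f x
      ≤ ((glauber c) ^ a) (((glauber (fun _ _ => q)) ^ T) f) x + T * η := by
  have hqc : ∀ (e : E) (x : E → Bool), (fun (_ : E) (_ : E → Bool) => q) e x ∈ Set.Icc (0 : ℝ) 1 :=
    fun _ _ => hq
  induction T generalizing f with
  | zero => simp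
  | succ T ih =>
    have hstep : glauber c f ≤ glauber (fun _ _ => q) f + B := by
      intro y
      rw [Pi.add_apply]
      by_cases hy : B y < 1
      · have : glauber c f y ≤ glauber (fun _ _ => q) f y := by
          rw [glauber_apply, glauber_apply]
          refine mul_le_mul_of_nonneg_left (Finset.sum_le_sum fun e _ => ?_) (by positivity)
          have h1 := hB y hy e
          have h2 := hfσ e y
          rcases hσ with rfl | rfl <;> nlinarith
        linarith [hB0 y]
      · have h1 : glauber c f y ≤ 1 := by
          simpa using glauber_pow_le_of_le hc 1 (fun x => (hf x).2) y
        have h2 : 0 ≤ glauber (fun _ _ => q) f y := by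
          simpa using le_glauber_pow_of_le hqc 1 (fun x => (hf x).1) y
        linarith
    have h1 := glauber_pow_mono hc (a + T) hstep x
    rw [map_add, Pi.add_apply] at h1
    have h2 := ih (fun s h h' => hη s h (by omega)) (f := glauber (fun _ _ => q) f)
      (fun y => ⟨by simpa using le_glauber_pow_of_le hqc 1 (fun x => (hf x).1) y,
        by simpa using glauber_pow_le_of_le hqc 1 (fun x => (hf x).2) y⟩)
      (hfσ.glauber_const_rate hq)
    have h3 := hη (a + T) (by omega) (by omega) x
    rw [← add_assoc, pow_succ, Module.End.mul_apply, pow_succ (glauber fun _ _ => q),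
      Module.End.mul_apply]
    push_cast
    linarith

lemma glauber_pow_add_le_bernMean [Nonempty E] {c : E → (E → Bool) → ℝ}
    (hc : ∀ e x, c e x ∈ Set.Icc (0 : ℝ) 1) {σ q : ℝ} (hσ : σ = 1 ∨ σ = -1)
    (hq : q ∈ Set.Icc (0 : ℝ) 1)
    {B : (E → Bool) → ℝ} (hB0 : ∀ x, 0 ≤ B x)
    (hB : ∀ x, B x < 1 → ∀ e, σ * (c e x - q) ≤ 0) {a : ℕ} {η : ℝ} (T : ℕ)
    (hη : ∀ s, a ≤ s → s ≤ a + T → ∀ x, ((glauber c) ^ s) B x ≤ η)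
    {f : (E → Bool) → ℝ} (hf : ∀ x, f x ∈ Set.Icc (0 : ℝ) 1) (hfσ : SignedMono σ f)
    (x : E → Bool) :
    ((glauber c) ^ (a + T)) f x
      ≤ bernMean q f + Fintype.card E * (1 - (Fintype.card E : ℝ)⁻¹) ^ T + T * η := by
  refine (glauber_pow_add_le hc hσ hq hB0 hB T hη hf hfσ x).trans ?_
  gcongr
  exact glauber_pow_le_of_le hc a (glauber_const_rate_pow_le hq T hf) x

end Dynamics

section Polynomial

variable {E J : Type*} [Fintype E] [DecidableEq E] [Fintype J]

lemma allTrue_update_sub (R : Finset E) (e : E) (x : E → Bool) :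
    allTrue R (Function.update x e true) - allTrue R (Function.update x e false)
      = if e ∈ R then allTrue (R.erase e) x else 0 := by
  have h1 : (∀ f ∈ R, Function.update x e true f = true) ↔ ∀ f ∈ R.erase e, x f = true := by
    refine ⟨fun h f hf => ?_, fun h f hf => ?_⟩
    · have := h f (Finset.mem_of_mem_erase hf)
      rwa [Function.update_of_ne (Finset.ne_of_mem_erase hf)] at this
    · by_cases hfe : f = e
      · subst hfe; simp
      · rw [Function.update_of_ne hfe]
        exact h f (Finset.mem_erase.2 ⟨hfe, hf⟩)
  have h2 : (∀ f ∈ R, Function.update x e false f = true)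
      ↔ e ∉ R ∧ ∀ f ∈ R.erase e, x f = true := by
    refine ⟨fun h => ⟨fun he => ?_, fun f hf => ?_⟩, fun h f hf => ?_⟩
    · simpa using h e he
    · have := h f (Finset.mem_of_mem_erase hf)
      rwa [Function.update_of_ne (Finset.ne_of_mem_erase hf)] at this
    · have hfe : f ≠ e := fun hfe => h.1 (hfe ▸ hf)
      rw [Function.update_of_ne hfe]
      exact h.2 f (Finset.mem_erase.2 ⟨hfe, hf⟩)
  simp only [allTrue, h1, h2]
  by_cases he : e ∈ R <;> simp [he]

lemma allTrue_nonneg (R : Finset E) (x : E → Bool) : 0 ≤ allTrue R x := by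
  rw [allTrue]; split_ifs <;> norm_num

lemma allTrue_le_one (R : Finset E) (x : E → Bool) : allTrue R x ≤ 1 := by
  rw [allTrue]; split_ifs <;> norm_num

lemma allTrue_mono (R : Finset E) : Monotone (allTrue R) := by
  intro x y hxy
  rw [allTrue]
  split_ifs with h
  · have : ∀ e ∈ R, y e = true := fun e he => by
      have := hxy e
      rw [h e he] at this
      revert this
      cases y e <;> simp
    rw [allTrue, if_pos this]
  · exact allTrue_nonneg R y

lemma allTrue_sub_le (R : Finset E) {x y : E → Bool} (hxy : x ≤ y) :
    allTrue R y - allTrue R x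
      ≤ ∑ f ∈ R, ((if y f = true then (1 : ℝ) else 0) - if x f = true then 1 else 0)
        * allTrue (R.erase f) y := by
  have hnn : ∀ f, 0 ≤ ((if y f = true then (1 : ℝ) else 0) - if x f = true then 1 else 0)
        * allTrue (R.erase f) y := by
    intro f
    refine mul_nonneg ?_ (allTrue_nonneg _ _)
    have := hxy f
    revert this
    cases x f <;> cases y f <;> simp
  by_cases hy : ∀ e ∈ R, y e = true
  · by_cases hx : ∀ e ∈ R, x e = true
    · simp only [allTrue, if_pos hx, if_pos hy, sub_self]
      exact Finset.sum_nonneg fun f _ => hnn f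
    · push Not at hx
      obtain ⟨e, he, hxe⟩ := hx
      refine le_trans ?_ (Finset.single_le_sum (fun f _ => hnn f) he)
      have h1 : allTrue (R.erase e) y = 1 :=
        if_pos fun f hf => hy f (Finset.mem_of_mem_erase hf)
      rw [h1, if_pos (hy e he), if_neg hxe]
      linarith [allTrue_le_one R y, allTrue_nonneg R x]
  · have h1 : allTrue R y = 0 := if_neg hy
    have h2 := allTrue_nonneg R x
    linarith [Finset.sum_nonneg fun f (_ : f ∈ R) => hnn f]

/-- The discrete derivative at `e` of the polynomial `∑ j, w j * ∏ f ∈ S j, x f`. -/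
noncomputable def linkWeight (w : J → ℝ) (S : J → Finset E) (e : E) (x : E → Bool) : ℝ :=
  ∑ j, if e ∈ S j then w j * allTrue ((S j).erase e) x else 0

/-- The sum over `f ≠ e` of the second discrete derivatives at `e, f` of the polynomial
`∑ j, w j * ∏ f ∈ S j, x f`. -/
noncomputable def pairWeight (w : J → ℝ) (S : J → Finset E) (e : E) (x : E → Bool) : ℝ :=
  ∑ j, if e ∈ S j then w j * ∑ f ∈ (S j).erase e, allTrue (((S j).erase e).erase f) x else 0

/-- The total weight of the monomials containing the two distinct coordinates `e` and `g`. -/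
noncomputable def codegree (w : J → ℝ) (S : J → Finset E) (e g : E) : ℝ :=
  ∑ j, if e ∈ S j ∧ g ∈ (S j).erase e then w j else 0

variable {w : J → ℝ} {S : J → Finset E}

lemma sum_mul_allTrue_update_sub (e : E) (x : E → Bool) :
    (∑ j, w j * allTrue (S j) (Function.update x e true))
      - ∑ j, w j * allTrue (S j) (Function.update x e false) = linkWeight w S e x := by
  rw [← Finset.sum_sub_distrib, linkWeight]
  refine Finset.sum_congr rfl fun j _ => ?_
  rw [← mul_sub, allTrue_update_sub]
  split_ifs <;> simp

lemma linkWeight_mono (hw : ∀ j, 0 ≤ w j) (e : E) : Monotone (linkWeight w S e) := by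
  intro x y hxy
  refine Finset.sum_le_sum fun j _ => ?_
  split_ifs
  · exact mul_le_mul_of_nonneg_left (allTrue_mono _ hxy) (hw j)
  · exact le_rfl

lemma pairWeight_mono (hw : ∀ j, 0 ≤ w j) (e : E) : Monotone (pairWeight w S e) := by
  intro x y hxy
  refine Finset.sum_le_sum fun j _ => ?_
  split_ifs
  · exact mul_le_mul_of_nonneg_left (Finset.sum_le_sum fun f _ => allTrue_mono _ hxy) (hw j)
  · exact le_rfl

lemma abs_allTrue_update_sub_le (R : Finset E) (e : E) (x : E → Bool) :
    |allTrue R (Function.update x e true) - allTrue R (Function.update x e false)|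
      ≤ if e ∈ R then 1 else 0 := by
  rw [allTrue_update_sub]
  split_ifs
  · rw [abs_of_nonneg (allTrue_nonneg _ _)]
    exact allTrue_le_one _ _
  · simp

lemma abs_linkWeight_update_sub_le (hw : ∀ j, 0 ≤ w j) (e g : E) (x : E → Bool) :
    |linkWeight w S e (Function.update x g true) - linkWeight w S e (Function.update x g false)|
      ≤ codegree w S e g := by
  rw [linkWeight, linkWeight, codegree, ← Finset.sum_sub_distrib]
  refine (Finset.abs_sum_le_sum_abs _ _).trans (Finset.sum_le_sum fun j _ => ?_)
  by_cases he : e ∈ S j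
  · simp only [he, if_true, true_and]
    rw [← mul_sub, abs_mul, abs_of_nonneg (hw j)]
    refine (mul_le_mul_of_nonneg_left (abs_allTrue_update_sub_le _ _ _) (hw j)).trans_eq ?_
    split_ifs <;> simp
  · simp [he]

lemma abs_pairWeight_update_sub_le (hw : ∀ j, 0 ≤ w j) {D : ℕ} (hD : ∀ j, (S j).card ≤ D)
    (e g : E) (x : E → Bool) :
    |pairWeight w S e (Function.update x g true) - pairWeight w S e (Function.update x g false)|
      ≤ D * codegree w S e g := by
  rw [pairWeight, pairWeight, codegree, ← Finset.sum_sub_distrib, Finset.mul_sum]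
  refine (Finset.abs_sum_le_sum_abs _ _).trans (Finset.sum_le_sum fun j _ => ?_)
  by_cases he : e ∈ S j
  · simp only [he, if_true, true_and]
    rw [← mul_sub, abs_mul, abs_of_nonneg (hw j), ← Finset.sum_sub_distrib]
    have : |∑ f ∈ (S j).erase e, (allTrue (((S j).erase e).erase f) (Function.update x g true)
        - allTrue (((S j).erase e).erase f) (Function.update x g false))|
        ≤ D * if g ∈ (S j).erase e then 1 else 0 := by
      calc _ ≤ ∑ f ∈ (S j).erase e, if g ∈ (S j).erase e then (1 : ℝ) else 0 := by
            refine (Finset.abs_sum_le_sum_abs _ _).trans (Finset.sum_le_sum fun f _ => ?_)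
            refine (abs_allTrue_update_sub_le _ _ _).trans ?_
            split_ifs with h1 h2
            · exact le_rfl
            · exact absurd (Finset.mem_of_mem_erase h1) h2
            · norm_num
            · exact le_rfl
        _ ≤ _ := by
            rw [Finset.sum_const, nsmul_eq_mul]
            gcongr
            exact (Finset.card_le_card (Finset.erase_subset _ _)).trans (hD j)
    refine (mul_le_mul_of_nonneg_left this (hw j)).trans_eq ?_
    split_ifs <;> simp; ring
  · simp [he]

lemma codegree_nonneg (hw : ∀ j, 0 ≤ w j) (e g : E) : 0 ≤ codegree w S e g :=
  Finset.sum_nonneg fun j _ => by split_ifs; exacts [hw j, le_rfl]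

/-- The sum of squared codegrees is controlled by the degree and the maximal codegree. -/
lemma sum_codegree_sq_le (hw : ∀ j, 0 ≤ w j) {D : ℕ} (hD : ∀ j, (S j).card ≤ D) {W K : ℝ} (e : E)
    (hW : ∑ j, (if e ∈ S j then w j else 0) ≤ W) (hK : ∀ g, codegree w S e g ≤ K) :
    ∑ g, codegree w S e g ^ 2 ≤ K * (D * W) := by
  have hK0 : 0 ≤ K := (codegree_nonneg hw e e).trans (hK e)
  have hsum : ∑ g, codegree w S e g ≤ D * W := by
    calc ∑ g, codegree w S e g
        = ∑ j, ∑ g, if e ∈ S j ∧ g ∈ (S j).erase e then w j else 0 := Finset.sum_comm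
      _ ≤ ∑ j, D * (if e ∈ S j then w j else 0) := by
          refine Finset.sum_le_sum fun j _ => ?_
          by_cases he : e ∈ S j
          · simp only [he, true_and, if_true]
            rw [Finset.sum_ite_mem, Finset.univ_inter, Finset.sum_const, nsmul_eq_mul]
            gcongr
            · exact hw j
            · exact (Finset.card_le_card (Finset.erase_subset _ _)).trans (hD j)
          · simp [he]
      _ ≤ _ := by rw [← Finset.mul_sum]; gcongr
  calc ∑ g, codegree w S e g ^ 2 ≤ ∑ g, K * codegree w S e g := by
        refine Finset.sum_le_sum fun g _ => ?_
        rw [sq]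
        exact mul_le_mul_of_nonneg_right (hK g) (codegree_nonneg hw e g)
    _ ≤ _ := by rw [← Finset.mul_sum]; gcongr

lemma bernMean_linkWeight (q : ℝ) (e : E) :
    bernMean q (linkWeight w S e)
      = ∑ j, if e ∈ S j then w j * q ^ ((S j).card - 1) else 0 := by
  have : linkWeight w S e = fun x => ∑ j, if e ∈ S j then w j * allTrue ((S j).erase e) x else 0 :=
    rfl
  rw [this, bernMean_sum]
  refine Finset.sum_congr rfl fun j _ => ?_
  split_ifs with he
  · simp only [mul_comm (w j)]
    rw [bernMean_mul_const, bernMean_allTrue, Finset.card_erase_of_mem he]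
  · exact bernMean_const q 0

lemma bernMean_pairWeight (q : ℝ) (e : E) :
    bernMean q (pairWeight w S e)
      = ∑ j, if e ∈ S j then w j * (((S j).card - 1 : ℕ) * q ^ ((S j).card - 2)) else 0 := by
  have : pairWeight w S e = fun x => ∑ j, if e ∈ S j then
    w j * ∑ f ∈ (S j).erase e, allTrue (((S j).erase e).erase f) x else 0 := rfl
  rw [this, bernMean_sum]
  refine Finset.sum_congr rfl fun j _ => ?_
  split_ifs with he
  · simp only [mul_comm (w j)]
    rw [bernMean_mul_const, bernMean_sum]
    congr 1
    rw [← Finset.card_erase_of_mem he, ← nsmul_eq_mul, ← Finset.sum_const]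
    refine Finset.sum_congr rfl fun f hf => ?_
    rw [bernMean_allTrue, Finset.card_erase_of_mem hf, Finset.card_erase_of_mem he, Nat.sub_sub]
  · exact bernMean_const q 0

lemma sum_linkWeight_sub_le (hw : ∀ j, 0 ≤ w j) {x y : E → Bool} (hxy : x ≤ y) :
    ∑ e, (linkWeight w S e y - linkWeight w S e x)
      ≤ ∑ f, ((if y f = true then (1 : ℝ) else 0) - if x f = true then 1 else 0)
        * pairWeight w S f y := by
  set d : E → ℝ := fun f => (if y f = true then (1 : ℝ) else 0) - if x f = true then 1 else 0
    with hd
  have h1 : ∑ e, (linkWeight w S e y - linkWeight w S e x)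
      = ∑ j, w j * ∑ e ∈ S j, (allTrue ((S j).erase e) y - allTrue ((S j).erase e) x) := by
    simp only [linkWeight, ← Finset.sum_sub_distrib]
    rw [Finset.sum_comm]
    refine Finset.sum_congr rfl fun j _ => ?_
    rw [Finset.mul_sum, ← Finset.univ_inter (S j), ← Finset.sum_ite_mem, Finset.univ_inter]
    refine Finset.sum_congr rfl fun e _ => ?_
    split_ifs <;> ring
  have h2 : ∑ f, d f * pairWeight w S f y
      = ∑ j, w j * ∑ f ∈ S j, ∑ e ∈ (S j).erase f,
        d f * allTrue (((S j).erase f).erase e) y := by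
    simp only [pairWeight]
    rw [Finset.sum_congr rfl fun f _ => Finset.mul_sum _ _ (d f), Finset.sum_comm]
    refine Finset.sum_congr rfl fun j _ => ?_
    rw [Finset.mul_sum, ← Finset.univ_inter (S j), ← Finset.sum_ite_mem, Finset.univ_inter]
    refine Finset.sum_congr rfl fun e _ => ?_
    split_ifs
    · rw [← Finset.mul_sum]; ring
    · ring
  rw [h1, h2]
  refine Finset.sum_le_sum fun j _ => mul_le_mul_of_nonneg_left ?_ (hw j)
  calc ∑ e ∈ S j, (allTrue ((S j).erase e) y - allTrue ((S j).erase e) x)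
      ≤ ∑ e ∈ S j, ∑ f ∈ (S j).erase e, d f * allTrue (((S j).erase e).erase f) y :=
        Finset.sum_le_sum fun e _ => allTrue_sub_le _ hxy
    _ = _ := by
        rw [Finset.sum_comm' (t' := S j) (s' := fun f => (S j).erase f)]
        · refine Finset.sum_congr rfl fun f _ => Finset.sum_congr rfl fun e _ => ?_
          rw [Finset.erase_right_comm]
        · intro a b
          simp only [Finset.mem_erase]
          tauto

end Polynomial

section Counting

open scoped Classical in
/-- The set of edges of the copy of `G` given by `ψ`. -/
noncomputable def copyEdges {n m : ℕ} (G : SimpleGraph (Fin m)) (ψ : Fin m ↪ Fin n) :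
    Finset (EdgeSet n) :=
  Finset.univ.filter fun e => ∃ a b, G.Adj a b ∧ e.1 = s(ψ a, ψ b)

lemma mem_copyEdges {n m : ℕ} {G : SimpleGraph (Fin m)} {ψ : Fin m ↪ Fin n} {e : EdgeSet n} :
    e ∈ copyEdges G ψ ↔ ∃ a b, G.Adj a b ∧ e.1 = s(ψ a, ψ b) := by
  simp [copyEdges]

lemma NG_eq_sum_allTrue {n m : ℕ} (G : SimpleGraph (Fin m)) (x : Config n) :
    NG G x = ∑ ψ : Fin m ↪ Fin n, allTrue (copyEdges G ψ) x := by
  classical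
  refine Finset.sum_congr rfl fun ψ _ => ?_
  have hval : ∀ a b, G.Adj a b → ∀ h : ¬ (s(ψ a, ψ b) : Sym2 (Fin n)).IsDiag,
      edgeInd x (ψ a) (ψ b) = if x ⟨s(ψ a, ψ b), h⟩ = true then 1 else 0 := by
    intro a b _ h
    rw [edgeInd, edgeVal, dif_neg h]
  have hdiag : ∀ a b, G.Adj a b → ¬ (s(ψ a, ψ b) : Sym2 (Fin n)).IsDiag := by
    intro a b hab h
    rw [Sym2.mk_isDiag_iff] at h
    exact hab.ne (ψ.injective h)
  rw [allTrue]
  split_ifs with hx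
  · refine Finset.prod_eq_one fun a _ => Finset.prod_eq_one fun b _ => ?_
    split_ifs with hab
    · rw [hval a b hab (hdiag a b hab), if_pos]
      exact hx _ (mem_copyEdges.2 ⟨a, b, hab, rfl⟩)
    · rfl
  · push Not at hx
    obtain ⟨e, he, hxe⟩ := hx
    obtain ⟨a, b, hab, hab'⟩ := mem_copyEdges.1 he
    refine Finset.prod_eq_zero (Finset.mem_univ a) (Finset.prod_eq_zero (Finset.mem_univ b) ?_)
    have : e = ⟨s(ψ a, ψ b), hdiag a b hab⟩ := Subtype.ext hab'
    rw [if_pos hab, hval a b hab (hdiag a b hab), if_neg]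
    rwa [← this]

lemma card_copyEdges {n m : ℕ} (G : SimpleGraph (Fin m)) (ψ : Fin m ↪ Fin n) :
    (copyEdges G ψ).card = numEdges G := by
  classical
  have h : ((copyEdges G ψ).image Subtype.val : Finset (Sym2 (Fin n)))
      = G.edgeFinset.image (Sym2.map ψ) := by
    ext p
    simp only [Finset.mem_image, mem_copyEdges, SimpleGraph.mem_edgeFinset]
    constructor
    · rintro ⟨e, ⟨a, b, hab, he⟩, rfl⟩
      exact ⟨s(a, b), hab, by rw [he]; rfl⟩
    · rintro ⟨p, hp, rfl⟩
      induction p using Sym2.ind with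
      | _ a b =>
        have hab : G.Adj a b := hp
        refine ⟨⟨s(ψ a, ψ b), ?_⟩, ⟨a, b, hab, rfl⟩, rfl⟩
        rw [Sym2.mk_isDiag_iff]
        exact fun h => hab.ne (ψ.injective h)
  rw [← Finset.card_image_of_injective _ Subtype.val_injective, h,
    Finset.card_image_of_injective _ (Sym2.map.injective ψ.injective), numEdges,
    ← SimpleGraph.coe_edgeFinset, Set.ncard_coe_finset]

open scoped Classical in
/-- The number of copies of `G` in the complete graph containing the edge `e`. -/
noncomputable def copyCount {n m : ℕ} (G : SimpleGraph (Fin m)) (e : EdgeSet n) : ℕ :=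
  (Finset.univ.filter fun ψ : Fin m ↪ Fin n => e ∈ copyEdges G ψ).card

lemma copyCount_eq_copyCount {n m : ℕ} (G : SimpleGraph (Fin m)) (e f : EdgeSet n) :
    copyCount G e = copyCount G f := by
  classical
  obtain ⟨σ, hσ⟩ : ∃ σ : Equiv.Perm (Fin n), Sym2.map σ e.1 = f.1 := by
    obtain ⟨p, hp⟩ := e
    obtain ⟨r, hr⟩ := f
    induction p using Sym2.ind with
    | _ u v =>
    induction r using Sym2.ind with
    | _ u' v' =>
      rw [Sym2.mk_isDiag_iff] at hp hr
      let a : Equiv.Perm (Fin n) := Equiv.swap u u'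
      have hav : u' ≠ a v := by
        intro h
        apply hp
        apply a.injective
        rw [← h]
        simp [a]
      refine ⟨a.trans (Equiv.swap (a v) v'), ?_⟩
      simp only [Sym2.map_mk, Equiv.trans_apply, Equiv.swap_apply_left]
      rw [show a u = u' by simp [a], Equiv.swap_apply_of_ne_of_ne hav hr]
  refine Finset.card_bij (fun ψ _ => ψ.trans σ.toEmbedding) ?_ ?_ ?_
  · intro ψ hψ
    simp only [Finset.mem_filter, Finset.mem_univ, true_and, mem_copyEdges] at hψ ⊢
    obtain ⟨a, b, hab, he⟩ := hψ
    exact ⟨a, b, hab, by rw [← hσ, he]; rfl⟩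
  · intro ψ _ ψ' _ h
    ext a
    have := DFunLike.congr_fun h a
    exact congrArg Fin.val (σ.injective this)
  · intro ψ hψ
    simp only [Finset.mem_filter, Finset.mem_univ, true_and, mem_copyEdges] at hψ
    obtain ⟨a, b, hab, he⟩ := hψ
    refine ⟨ψ.trans σ.symm.toEmbedding, ?_, ?_⟩
    · simp only [Finset.mem_filter, Finset.mem_univ, true_and, mem_copyEdges]
      refine ⟨a, b, hab, ?_⟩
      apply Sym2.map.injective σ.injective
      rw [hσ, he]
      simp
    · ext a; simp

lemma card_edgeSet (n : ℕ) : Fintype.card (EdgeSet n) = n.choose 2 := by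
  rw [Sym2.card_subtype_not_diag, Fintype.card_fin]

lemma copyCount_mul {n m : ℕ} (G : SimpleGraph (Fin m)) (e : EdgeSet n) :
    n.choose 2 * copyCount G e = numEdges G * n.descFactorial m := by
  classical
  have h1 : ∑ f : EdgeSet n, copyCount G f = n.choose 2 * copyCount G e := by
    rw [Finset.sum_congr rfl fun f _ => copyCount_eq_copyCount G f e]
    rw [Finset.sum_const, Finset.card_univ, card_edgeSet, smul_eq_mul]
  rw [← h1]
  have h2 : ∑ f : EdgeSet n, copyCount G f = ∑ ψ : Fin m ↪ Fin n, (copyEdges G ψ).card := by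
    simp only [copyCount, Finset.card_filter]
    rw [Finset.sum_comm]
    refine Finset.sum_congr rfl fun ψ _ => ?_
    simp
  rw [h2, Finset.sum_congr rfl fun ψ _ => card_copyEdges G ψ]
  simp [Fintype.card_embedding_eq, mul_comm]

/-- The normalised number of copies of `G` in `K_n` through a given edge. -/
noncomputable def copyDensity {m : ℕ} (G : SimpleGraph (Fin m)) (n : ℕ) : ℝ :=
  numEdges G * n.descFactorial m / (n.choose 2 * (n : ℝ) ^ (m - 2))

lemma copyCount_div_eq {n m : ℕ} (G : SimpleGraph (Fin m)) (e : EdgeSet n) :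
    (copyCount G e : ℝ) / (n : ℝ) ^ (m - 2) = copyDensity G n := by
  have hpos : 0 < n.choose 2 := by
    rw [← card_edgeSet]; exact Fintype.card_pos_iff.2 ⟨e⟩
  have h : (n.choose 2 : ℝ) ≠ 0 := by exact_mod_cast hpos.ne'
  rw [copyDensity, ← Nat.cast_mul, ← copyCount_mul G e, Nat.cast_mul, mul_div_mul_left _ _ h]

lemma two_le_of_numEdges_ne_zero {m : ℕ} {G : SimpleGraph (Fin m)} (h : numEdges G ≠ 0) :
    2 ≤ m := by
  by_contra hm
  apply h
  have : Subsingleton (Fin m) := Fin.subsingleton_iff_le_one.2 (by omega)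
  have hG : G = ⊥ := by
    ext a b
    simp [Subsingleton.elim a b]
  simp [numEdges, hG]

lemma tendsto_copyDensity {m : ℕ} (G : SimpleGraph (Fin m)) :
    Tendsto (copyDensity G) atTop (nhds (2 * numEdges G)) := by
  by_cases h : numEdges G = 0
  · have : copyDensity G = fun _ => 0 := by
      funext n; simp [copyDensity, h]
    rw [this, h]; simp
  have hm := two_le_of_numEdges_ne_zero h
  have h1 : Tendsto (fun n : ℕ => (n.descFactorial m : ℝ) / (n : ℝ) ^ m) atTop (nhds 1) := by
    have := isEquivalent_descFactorial m
    refine (Asymptotics.isEquivalent_iff_tendsto_one ?_).1 this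
    filter_upwards [eventually_gt_atTop 0] with n hn
    positivity
  have h2 : Tendsto (fun n : ℕ => (n.choose 2 : ℝ) / (n : ℝ) ^ 2) atTop (nhds (1 / 2)) := by
    have h3 : Tendsto (fun n : ℕ => (1 / 2 : ℝ) * (1 - 1 / (n : ℝ))) atTop
        (nhds (1 / 2 * (1 - 0))) :=
      (tendsto_const_nhds.sub tendsto_one_div_atTop_nhds_zero_nat).const_mul _
    rw [sub_zero, mul_one] at h3
    refine h3.congr' ?_
    filter_upwards [eventually_gt_atTop 0] with n hn
    have : (n : ℝ) ≠ 0 := by positivity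
    rw [Nat.cast_choose_two]
    field_simp
  have h3 := (h1.div h2 (by norm_num)).const_mul (numEdges G : ℝ)
  rw [show (numEdges G : ℝ) * (1 / (1 / 2)) = 2 * numEdges G by ring] at h3
  refine h3.congr' ?_
  filter_upwards [eventually_gt_atTop 1] with n hn
  have hn0 : (n : ℝ) ≠ 0 := by positivity
  have hc : (n.choose 2 : ℝ) ≠ 0 := by
    exact_mod_cast (Nat.choose_pos hn).ne'
  obtain ⟨k, rfl⟩ := Nat.exists_eq_add_of_le' hm
  simp only [Pi.div_apply, copyDensity, Nat.add_sub_cancel]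
  field_simp
  ring

open scoped Classical in
/-- Few copies of `G` contain two given distinct edges. -/
lemma card_copies_containing_two_le {n m : ℕ} (G : SimpleGraph (Fin m)) (e g : EdgeSet n) :
    ((Finset.univ.filter fun ψ : Fin m ↪ Fin n =>
      e ∈ copyEdges G ψ ∧ g ∈ (copyEdges G ψ).erase e).card : ℝ) / (n : ℝ) ^ (m - 2)
      ≤ (m : ℝ) ^ 3 / n := by
  set A := Finset.univ.filter fun ψ : Fin m ↪ Fin n =>
      e ∈ copyEdges G ψ ∧ g ∈ (copyEdges G ψ).erase e with hA
  by_cases hge : g = e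
  · have : A = ∅ := by
      rw [hA, Finset.filter_eq_empty_iff]
      simp [hge]
    rw [this]
    simp only [Finset.card_empty, Nat.cast_zero, zero_div]
    positivity
  obtain ⟨u, v, w, huv, huw, hvw, he, hw⟩ : ∃ u v w : Fin n, u ≠ v ∧ u ≠ w ∧ v ≠ w ∧
      e.1 = s(u, v) ∧ w ∈ g.1 := by
    obtain ⟨p, hp⟩ := e
    obtain ⟨r, hr⟩ := g
    induction p using Sym2.ind with
    | _ u v =>
    induction r using Sym2.ind with
    | _ a b =>
      rw [Sym2.mk_isDiag_iff] at hp hr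
      have hne : s(a, b) ≠ s(u, v) := fun h => hge (Subtype.ext h)
      have : (a ≠ u ∧ a ≠ v) ∨ (b ≠ u ∧ b ≠ v) := by
        by_contra hcon
        apply hne
        rw [Sym2.eq_iff]
        grind
      rcases this with h | h
      · exact ⟨u, v, a, hp, h.1.symm, h.2.symm, rfl, by simp⟩
      · exact ⟨u, v, b, hp, h.1.symm, h.2.symm, rfl, by simp⟩
  have hsub : A ⊆ Finset.univ.biUnion fun t : Fin m × Fin m × Fin m =>
      Finset.univ.filter fun ψ : Fin m ↪ Fin n => ψ t.1 = u ∧ ψ t.2.1 = v ∧ ψ t.2.2 = w := by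
    intro ψ hψ
    rw [hA, Finset.mem_filter, Finset.mem_erase, mem_copyEdges, mem_copyEdges] at hψ
    obtain ⟨-, ⟨a, b, -, hab⟩, -, c, d, -, hcd⟩ := hψ
    rw [he] at hab
    rw [hcd, Sym2.mem_iff] at hw
    simp only [Finset.mem_biUnion, Finset.mem_univ, true_and, Finset.mem_filter, Prod.exists]
    rw [Sym2.eq_iff] at hab
    rcases hab with ⟨h1, h2⟩ | ⟨h1, h2⟩ <;> rcases hw with h3 | h3
    · exact ⟨a, b, c, h1.symm, h2.symm, h3.symm⟩
    · exact ⟨a, b, d, h1.symm, h2.symm, h3.symm⟩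
    · exact ⟨b, a, c, h1.symm, h2.symm, h3.symm⟩
    · exact ⟨b, a, d, h1.symm, h2.symm, h3.symm⟩
  have hfib : ∀ t : Fin m × Fin m × Fin m,
      (Finset.univ.filter fun ψ : Fin m ↪ Fin n =>
        ψ t.1 = u ∧ ψ t.2.1 = v ∧ ψ t.2.2 = w).card ≤ n ^ (m - 3) := by
    rintro ⟨a, b, c⟩
    rcases Finset.eq_empty_or_nonempty (Finset.univ.filter fun ψ : Fin m ↪ Fin n =>
        ψ a = u ∧ ψ b = v ∧ ψ c = w) with h | ⟨ψ₀, h₀⟩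
    · simp only [h, Finset.card_empty]; exact Nat.zero_le _
    obtain ⟨-, ha, hb, hc⟩ := Finset.mem_filter.1 h₀
    have hab : a ≠ b := by rintro rfl; exact huv (ha.symm.trans hb)
    have hac : a ≠ c := by rintro rfl; exact huw (ha.symm.trans hc)
    have hbc : b ≠ c := by rintro rfl; exact hvw (hb.symm.trans hc)
    have hcard : Fintype.card ({y : Fin m // y ∉ ({a, b, c} : Finset (Fin m))} → Fin n)
        = n ^ (m - 3) := by
      rw [Fintype.card_fun, Fintype.card_fin, Fintype.card_subtype_compl, Fintype.card_fin,
        Fintype.card_coe, Finset.card_eq_three.2 ⟨a, b, c, hab, hac, hbc, rfl⟩]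
    rw [← hcard, ← Finset.card_univ]
    refine Finset.card_le_card_of_injOn (fun ψ y => ψ y.1) (fun _ _ => Finset.mem_coe.2
      (Finset.mem_univ _)) ?_
    intro ψ hψ ψ' hψ' h
    obtain ⟨-, ha1, hb1, hc1⟩ := Finset.mem_filter.1 (Finset.mem_coe.1 hψ)
    obtain ⟨-, ha2, hb2, hc2⟩ := Finset.mem_filter.1 (Finset.mem_coe.1 hψ')
    refine DFunLike.ext _ _ fun y => ?_
    by_cases hy : y ∈ ({a, b, c} : Finset (Fin m))
    · simp only [Finset.mem_insert, Finset.mem_singleton] at hy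
      simp only at ha1 hb1 hc1 ha2 hb2 hc2
      rcases hy with rfl | rfl | rfl
      · rw [ha1, ha2]
      · rw [hb1, hb2]
      · rw [hc1, hc2]
    · exact congrFun h ⟨y, hy⟩
  have hbound : A.card ≤ m ^ 3 * n ^ (m - 3) := by
    refine (Finset.card_le_card hsub).trans (Finset.card_biUnion_le.trans ?_)
    refine (Finset.sum_le_sum fun t _ => hfib t).trans_eq ?_
    simp only [Finset.sum_const, Finset.card_univ, Fintype.card_prod, Fintype.card_fin, smul_eq_mul]
    ring
  have hn : 0 < n := u.pos
  rcases Finset.eq_empty_or_nonempty A with h | ⟨ψ, hψ⟩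
  · rw [h]
    simp only [Finset.card_empty, Nat.cast_zero, zero_div]
    positivity
  have hm : 3 ≤ m := by
    obtain ⟨⟨a, b, c⟩, -, ht⟩ := Finset.mem_biUnion.1 (hsub hψ)
    obtain ⟨-, ha, hb, hc⟩ := Finset.mem_filter.1 ht
    simp only at ha hb hc
    have hab : a ≠ b := by rintro rfl; exact huv (ha.symm.trans hb)
    have hac : a ≠ c := by rintro rfl; exact huw (ha.symm.trans hc)
    have hbc : b ≠ c := by rintro rfl; exact hvw (hb.symm.trans hc)
    have := Finset.card_le_univ ({a, b, c} : Finset (Fin m))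
    rwa [Finset.card_eq_three.2 ⟨a, b, c, hab, hac, hbc, rfl⟩, Fintype.card_fin] at this
  obtain ⟨k, rfl⟩ := Nat.exists_eq_add_of_le' hm
  have hn' : (0 : ℝ) < n := by exact_mod_cast hn
  rw [div_le_div_iff₀ (by positivity) hn']
  have hb' : (A.card : ℝ) ≤ ((k + 3 : ℕ) : ℝ) ^ 3 * (n : ℝ) ^ k := by exact_mod_cast hbound
  calc (A.card : ℝ) * n ≤ ((k + 3 : ℕ) : ℝ) ^ 3 * (n : ℝ) ^ k * n := by gcongr
    _ = _ := by
      rw [show k + 3 - 2 = k + 1 by omega]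
      ring

end Counting

section HamiltonianPolynomial

variable {s : ℕ} (V : Fin s → ℕ) (G : ∀ i, SimpleGraph (Fin (V i))) (β : Fin s → ℝ)

/-- Indices of the monomials of the Hamiltonian: a graph of the family with an embedding. -/
abbrev CopyIndex (n : ℕ) : Type := Σ i : Fin s, (Fin (V i) ↪ Fin n)

/-- The coefficient of a monomial of the Hamiltonian. -/
noncomputable def copyWeight (n : ℕ) (j : CopyIndex V n) : ℝ := β j.1 / (n : ℝ) ^ (V j.1 - 2)

/-- The set of variables of a monomial of the Hamiltonian. -/
noncomputable def copySupport (n : ℕ) (j : CopyIndex V n) : Finset (EdgeSet n) :=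
  copyEdges (G j.1) j.2

lemma hamiltonian_eq {n : ℕ} (x : Config n) :
    Hamiltonian V G β x
      = ∑ j : CopyIndex V n, copyWeight V β n j * allTrue (copySupport V G n j) x := by
  rw [Fintype.sum_sigma, Hamiltonian]
  refine Finset.sum_congr rfl fun i _ => ?_
  rw [NG_eq_sum_allTrue, Finset.mul_sum, Finset.sum_div]
  refine Finset.sum_congr rfl fun ψ _ => ?_
  simp only [copyWeight, copySupport]
  ring

lemma dHam_eq {n : ℕ} (e : EdgeSet n) :
    dHam V G β e = linkWeight (copyWeight V β n) (copySupport V G n) e := by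
  funext x
  rw [dHam, hamiltonian_eq, hamiltonian_eq, sum_mul_allTrue_update_sub]

variable {β} in
lemma copyWeight_nonneg (hβ : ∀ i, 0 < β i) (n : ℕ) (j : CopyIndex V n) :
    0 ≤ copyWeight V β n j :=
  div_nonneg (hβ _).le (by positivity)

lemma card_copySupport (n : ℕ) (j : CopyIndex V n) :
    (copySupport V G n j).card = numEdges (G j.1) := card_copyEdges _ _

lemma card_copySupport_le (n : ℕ) (j : CopyIndex V n) :
    (copySupport V G n j).card ≤ ∑ i, numEdges (G i) := by
  rw [card_copySupport]
  exact Finset.single_le_sum (f := fun i => numEdges (G i)) (fun _ _ => Nat.zero_le _)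
    (Finset.mem_univ j.1)

lemma sum_copyWeight_mul {n : ℕ} (e : EdgeSet n) (a : Fin s → ℝ) :
    ∑ j : CopyIndex V n, (if e ∈ copySupport V G n j then copyWeight V β n j * a j.1 else 0)
      = ∑ i, β i * copyDensity (G i) n * a i := by
  classical
  rw [Fintype.sum_sigma]
  refine Finset.sum_congr rfl fun i _ => ?_
  rw [← copyCount_div_eq (G i) e, copyCount, Finset.card_filter, Nat.cast_sum, Finset.sum_div,
    Finset.mul_sum, Finset.sum_mul]
  refine Finset.sum_congr rfl fun ψ _ => ?_
  rw [show copySupport V G n ⟨i, ψ⟩ = copyEdges (G i) ψ from rfl]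
  simp only [copyWeight]
  by_cases h : e ∈ copyEdges (G i) ψ
  · rw [if_pos h, if_pos h]; push_cast; ring
  · rw [if_neg h, if_neg h]; simp

/-- The expectation of `dHam` under the product Bernoulli weight. -/
noncomputable def meanLink (q : ℝ) (n : ℕ) : ℝ :=
  ∑ i, β i * copyDensity (G i) n * q ^ (numEdges (G i) - 1)

/-- The expectation of the total second derivative of the Hamiltonian at an edge under the product
Bernoulli weight. -/
noncomputable def meanPair (q : ℝ) (n : ℕ) : ℝ :=
  ∑ i, β i * copyDensity (G i) n * ((numEdges (G i) - 1 : ℕ) * q ^ (numEdges (G i) - 2))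

/-- The derivative of `Psi`. -/
noncomputable def psiDeriv (q : ℝ) : ℝ :=
  ∑ i, 2 * β i * (numEdges (G i) : ℝ) * ((numEdges (G i) - 1 : ℕ) * q ^ (numEdges (G i) - 2))

lemma bernMean_dHam {n : ℕ} (q : ℝ) (e : EdgeSet n) :
    bernMean q (dHam V G β e) = meanLink V G β q n := by
  rw [dHam_eq, bernMean_linkWeight, meanLink, ← sum_copyWeight_mul V G β e]
  simp only [card_copySupport]

lemma bernMean_pair {n : ℕ} (q : ℝ) (e : EdgeSet n) :
    bernMean q (pairWeight (copyWeight V β n) (copySupport V G n) e) = meanPair V G β q n := by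
  rw [bernMean_pairWeight, meanPair, ← sum_copyWeight_mul V G β e]
  simp only [card_copySupport]

lemma tendsto_meanLink (q : ℝ) : Tendsto (meanLink V G β q) atTop (nhds (Psi V G β q)) := by
  refine tendsto_finsetSum _ fun i _ => ?_
  convert ((tendsto_copyDensity (G i)).const_mul (β i)).mul_const (q ^ (numEdges (G i) - 1)) using 2
  ring

lemma tendsto_meanPair (q : ℝ) : Tendsto (meanPair V G β q) atTop (nhds (psiDeriv V G β q)) := by
  refine tendsto_finsetSum _ fun i _ => ?_
  convert ((tendsto_copyDensity (G i)).const_mul (β i)).mul_const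
    ((numEdges (G i) - 1 : ℕ) * q ^ (numEdges (G i) - 2)) using 2
  ring

lemma hasDerivAt_Psi (q : ℝ) : HasDerivAt (Psi V G β) (psiDeriv V G β q) q := by
  have h := HasDerivAt.fun_sum (u := Finset.univ) (x := q) fun i (_ : i ∈ Finset.univ) =>
    (hasDerivAt_pow (numEdges (G i) - 1) q).const_mul (2 * β i * (numEdges (G i) : ℝ))
  exact h

lemma continuous_psiDeriv : Continuous (psiDeriv V G β) := by
  unfold psiDeriv
  fun_prop

variable {β} in
lemma codegree_copy_le (hβ : ∀ i, 0 < β i) {n : ℕ} (e g : EdgeSet n) :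
    codegree (copyWeight V β n) (copySupport V G n) e g ≤ (∑ i, β i * (V i : ℝ) ^ 3) / n := by
  classical
  rw [codegree, Fintype.sum_sigma, Finset.sum_div]
  refine Finset.sum_le_sum fun i _ => ?_
  have := mul_le_mul_of_nonneg_left (card_copies_containing_two_le (G i) e g) (hβ i).le
  rw [mul_div_assoc]
  refine le_trans (le_of_eq ?_) this
  rw [Finset.card_filter, Nat.cast_sum, Finset.sum_div, Finset.mul_sum]
  refine Finset.sum_congr rfl fun ψ _ => ?_
  rw [show copySupport V G n ⟨i, ψ⟩ = copyEdges (G i) ψ from rfl]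
  simp only [copyWeight]
  by_cases h : e ∈ copyEdges (G i) ψ ∧ g ∈ (copyEdges (G i) ψ).erase e
  · rw [if_pos h, if_pos h]; push_cast; ring
  · rw [if_neg h, if_neg h]; simp

variable {β} in
lemma exists_sum_codegree_sq_le (hβ : ∀ i, 0 < β i) :
    ∃ C : ℝ, 0 < C ∧ ∀ᶠ n : ℕ in atTop, ∀ e : EdgeSet n,
      ∑ g, codegree (copyWeight V β n) (copySupport V G n) e g ^ 2 ≤ C / n := by
  set K := ∑ i, β i * (V i : ℝ) ^ 3
  set D := ∑ i, numEdges (G i)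
  have hK : 0 ≤ K := Finset.sum_nonneg fun i _ => mul_nonneg (hβ i).le (by positivity)
  have h1 : ∀ᶠ n : ℕ in atTop, meanLink V G β 1 n ≤ |Psi V G β 1| + 1 := by
    filter_upwards [(tendsto_meanLink V G β 1).eventually_lt_const
      (show Psi V G β 1 < |Psi V G β 1| + 1 by linarith [le_abs_self (Psi V G β 1)])] with n hn
    exact hn.le
  refine ⟨K * (D * (|Psi V G β 1| + 1)) + 1, by positivity, ?_⟩
  filter_upwards [h1] with n hn e
  have hW : ∑ j, (if e ∈ copySupport V G n j then copyWeight V β n j else 0)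
      ≤ |Psi V G β 1| + 1 := by
    refine le_trans (le_of_eq ?_) hn
    have := sum_copyWeight_mul V G β e fun _ => 1
    simpa [meanLink] using this
  refine (sum_codegree_sq_le (copyWeight_nonneg V hβ n) (card_copySupport_le V G n) e hW
    (codegree_copy_le V G hβ e)).trans ?_
  rw [div_mul_eq_mul_div]
  gcongr
  linarith

end HamiltonianPolynomial

section Concentration

lemma eventually_mul_pow_mul_exp_le (C : ℝ) {c : ℝ} (hc : 0 < c) (k : ℕ) :
    ∀ᶠ n : ℕ in atTop, C * (n : ℝ) ^ k * Real.exp (-(c * n)) ≤ Real.exp (-(c / 2 * n)) := by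
  have h := (Real.tendsto_pow_mul_exp_neg_atTop_nhds_zero k).comp
    ((tendsto_natCast_atTop_atTop (R := ℝ)).const_mul_atTop (half_pos hc))
  have h' := h.const_mul (C / (c / 2) ^ k)
  rw [mul_zero] at h'
  filter_upwards [h'.eventually_lt_const one_pos] with n hn
  have hc2 : (c / 2) ^ k ≠ 0 := by positivity
  simp only [Function.comp_apply, mul_pow] at hn
  have e1 : C / (c / 2) ^ k * ((c / 2) ^ k * (n : ℝ) ^ k * Real.exp (-(c / 2 * n)))
      = C * (n : ℝ) ^ k * Real.exp (-(c / 2 * n)) := by field_simp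
  rw [e1] at hn
  have e2 : Real.exp (-(c * n)) = Real.exp (-(c / 2 * n)) * Real.exp (-(c / 2 * n)) := by
    rw [← Real.exp_add]; congr 1; ring
  rw [e2, ← mul_assoc]
  exact mul_le_of_le_one_left (Real.exp_nonneg _) hn.le

open scoped Classical in
/-- The indicator that, for some `e`, the function `F e` is beyond the level `m` (above it if
`σ = 1`, below it if `σ = -1`). -/
noncomputable def exceed {E : Type*} (σ : ℝ) (F : E → (E → Bool) → ℝ) (m : ℝ) (x : E → Bool) : ℝ :=
  if ∃ e, 0 < σ * (F e x - m) then 1 else 0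

lemma exceed_mem_Icc {E : Type*} (σ : ℝ) (F : E → (E → Bool) → ℝ) (m : ℝ) (x : E → Bool) :
    exceed σ F m x ∈ Set.Icc (0 : ℝ) 1 := by
  rw [exceed]; split_ifs <;> simp

lemma signedMono_exceed {E : Type*} [DecidableEq E] {σ : ℝ} (hσ : σ = 1 ∨ σ = -1)
    {F : E → (E → Bool) → ℝ} (hF : ∀ e, Monotone (F e)) (m : ℝ) :
    SignedMono σ (exceed σ F m) := by
  intro e x
  have hle : Function.update x e false ≤ Function.update x e true := by
    rw [update_le_update_iff]
    exact ⟨Bool.false_le _, fun _ _ => le_rfl⟩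
  have hFle : ∀ f, F f (Function.update x e false) ≤ F f (Function.update x e true) :=
    fun f => hF f hle
  rcases hσ with rfl | rfl
  · have : (∃ f, 0 < 1 * (F f (Function.update x e false) - m)) →
        ∃ f, 0 < 1 * (F f (Function.update x e true) - m) := by
      rintro ⟨f, hf⟩
      exact ⟨f, by linarith [hFle f]⟩
    simp only [exceed]
    split_ifs with h1 h2
    · simp
    · simp
    · exact absurd (this ‹_›) h1
    · simp
  · have : (∃ f, 0 < -1 * (F f (Function.update x e true) - m)) →
        ∃ f, 0 < -1 * (F f (Function.update x e false) - m) := by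
      rintro ⟨f, hf⟩
      exact ⟨f, by linarith [hFle f]⟩
    simp only [exceed]
    split_ifs with h1 h2
    · simp
    · exact absurd (this h1) h2
    · simp
    · simp

/-- If the mean of `F e` under the product Bernoulli weights stays strictly on the right side of
`m`, then some `F e` is beyond `m` only with exponentially small probability. -/
lemma exists_bernMean_exceed_le {q : ℝ} (hq : q ∈ Set.Icc (0 : ℝ) 1) {σ : ℝ}
    (hσ : σ = 1 ∨ σ = -1) (F : ∀ n, EdgeSet n → Config n → ℝ) {C : ℝ} (hC : 0 < C)
    (hF : ∀ᶠ n : ℕ in atTop, ∀ e : EdgeSet n, ∃ k : EdgeSet n → ℝ,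
      (∀ g x, |F n e (Function.update x g true) - F n e (Function.update x g false)| ≤ k g) ∧
        ∑ g, k g ^ 2 ≤ C / n)
    {mean : ℕ → ℝ} (hmean : ∀ n e, bernMean q (F n e) = mean n) {lim m : ℝ}
    (hlim : Tendsto mean atTop (nhds lim)) (hm : 0 < σ * (m - lim)) :
    ∃ c : ℝ, 0 < c ∧ ∀ᶠ n : ℕ in atTop,
      bernMean q (exceed σ (F n) m) ≤ Real.exp (-(c * n)) := by
  set ε := σ * (m - lim) / 2 with hε
  have hεpos : 0 < ε := half_pos hm
  have hev : ∀ᶠ n : ℕ in atTop, σ * mean n + ε ≤ σ * m := by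
    have h := (hlim.const_mul σ).eventually_lt_const (show σ * lim < σ * m - ε by
      rw [hε]; linarith)
    filter_upwards [h] with n hn
    linarith
  set c := ε ^ 2 / (2 * C) with hc
  have hcpos : 0 < c := by positivity
  refine ⟨c / 2, half_pos hcpos, ?_⟩
  filter_upwards [hF, hev, eventually_mul_pow_mul_exp_le 1 hcpos 2, eventually_gt_atTop 0]
    with n hFn hmn hpoly hn
  have hn' : (0 : ℝ) < n := by exact_mod_cast hn
  have hsingle : ∀ e : EdgeSet n,
      bernMean q (fun x => if σ * m < σ * F n e x then (1 : ℝ) else 0) ≤ Real.exp (-(c * n)) := by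
    intro e
    obtain ⟨k, hk, hk2⟩ := hFn e
    have hb : bernMean q (fun x => σ * F n e x) = σ * mean n := by
      simp only [mul_comm σ]
      rw [bernMean_mul_const, hmean]
    have habs : |σ| = 1 := by rcases hσ with rfl | rfl <;> simp
    have := bernMean_tail_le hq (fun x => σ * F n e x) k (fun g x => by
      rw [← mul_sub, abs_mul, habs, one_mul]; exact hk g x)
      (m := σ * m) (ε := ε) (lam := ε * n / C) (by positivity) (by rw [hb]; exact hmn)
    refine this.trans (Real.exp_le_exp.2 ?_)
    have h2 : (ε * n / C) ^ 2 * (∑ g, k g ^ 2) / 2 ≤ (ε * n / C) ^ 2 * (C / n) / 2 := by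
      gcongr
    refine (add_le_add_right h2 _).trans_eq ?_
    rw [hc]
    field_simp
    ring
  calc bernMean q (exceed σ (F n) m)
      ≤ bernMean q (fun x => ∑ e, if σ * m < σ * F n e x then (1 : ℝ) else 0) := by
        refine bernMean_mono hq fun x => ?_
        have hnn : ∀ e ∈ (Finset.univ : Finset (EdgeSet n)),
            (0 : ℝ) ≤ if σ * m < σ * F n e x then (1 : ℝ) else 0 := by
          intro e _; split_ifs <;> norm_num
        rw [exceed]
        split_ifs with h
        · obtain ⟨e, he⟩ := h
          refine le_trans (le_of_eq ?_) (Finset.single_le_sum hnn (Finset.mem_univ e))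
          rw [if_pos]
          linarith
        · exact Finset.sum_nonneg hnn
    _ ≤ ∑ e : EdgeSet n, Real.exp (-(c * n)) := by
        rw [bernMean_sum]
        exact Finset.sum_le_sum fun e _ => hsingle e
    _ = (n.choose 2 : ℕ) * Real.exp (-(c * n)) := by
        rw [Finset.sum_const, Finset.card_univ, card_edgeSet, nsmul_eq_mul]
    _ ≤ 1 * (n : ℝ) ^ 2 * Real.exp (-(c * n)) := by
        gcongr
        rw [one_mul]
        exact_mod_cast Nat.choose_le_pow n 2
    _ ≤ _ := hpoly

end Concentration

section Rate

lemma Phi_eq_sigmoid : Phi = Real.sigmoid := by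
  funext u
  have := Real.exp_pos u
  rw [Phi, Real.sigmoid_def, Real.exp_neg]
  field_simp
  ring

lemma Phi_strictMono : StrictMono Phi := Phi_eq_sigmoid ▸ Real.sigmoid_strictMono

lemma continuous_Phi : Continuous Phi := Phi_eq_sigmoid ▸ continuous_sigmoid

lemma Phi_mem_Ioo (u : ℝ) : Phi u ∈ Set.Ioo (0 : ℝ) 1 := by
  rw [Phi_eq_sigmoid]
  exact ⟨Real.sigmoid_pos u, Real.sigmoid_lt_one u⟩

lemma Phi_sub_le (a b : ℝ) : Phi b - Phi a ≤ Phi b * (1 - Phi a) * (b - a) := by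
  have e : Phi b - Phi a = Phi b * (1 - Phi a) * (1 - Real.exp (a - b)) := by
    have ha := Real.exp_pos a
    have hb := Real.exp_pos b
    rw [Phi, Phi, Real.exp_sub]
    field_simp
    ring
  rw [e]
  have h1 := (Phi_mem_Ioo b).1.le
  have h2 := (Phi_mem_Ioo a).2.le
  refine mul_le_mul_of_nonneg_left ?_ (mul_nonneg h1 (by linarith))
  linarith [Real.add_one_le_exp (a - b)]

variable {s : ℕ} (V : Fin s → ℕ) (G : ∀ i, SimpleGraph (Fin (V i))) (β : Fin s → ℝ)

/-- The heat-bath probability of setting the edge `e` to `true`. -/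
noncomputable def rate (n : ℕ) (e : EdgeSet n) (x : Config n) : ℝ := Phi (dHam V G β e x)

lemma rate_mem_Icc (n : ℕ) (e : EdgeSet n) (x : Config n) :
    rate V G β n e x ∈ Set.Icc (0 : ℝ) 1 := Set.Ioo_subset_Icc_self (Phi_mem_Ioo _)

lemma dHam_update {n : ℕ} (e : EdgeSet n) (x : Config n) (b : Bool) :
    dHam V G β e (Function.update x e b) = dHam V G β e x := by
  simp only [dHam, Function.update_idem]

lemma rate_update (n : ℕ) (e : EdgeSet n) (x : Config n) (b : Bool) :
    rate V G β n e (Function.update x e b) = rate V G β n e x := by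
  rw [rate, rate, dHam_update]

variable {β} in
lemma dHam_mono (hβ : ∀ i, 0 < β i) {n : ℕ} (e : EdgeSet n) : Monotone (dHam V G β e) := by
  rw [dHam_eq]
  exact linkWeight_mono (copyWeight_nonneg V hβ n) e

variable {β} in
lemma rate_mono (hβ : ∀ i, 0 < β i) (n : ℕ) (e : EdgeSet n) : Monotone (rate V G β n e) :=
  Phi_strictMono.monotone.comp (dHam_mono V G hβ e)

lemma sum_exp_hamiltonian_pos (n : ℕ) :
    0 < ∑ y : Config n, Real.exp (Hamiltonian V G β y) :=
  Finset.sum_pos (fun _ _ => Real.exp_pos _) Finset.univ_nonempty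

lemma ergmProb_nonneg {n : ℕ} (x : Config n) : 0 ≤ ergmProb V G β x :=
  div_nonneg (Real.exp_nonneg _) (sum_exp_hamiltonian_pos V G β n).le

lemma sum_ergmProb (n : ℕ) : ∑ x : Config n, ergmProb V G β x = 1 := by
  simp only [ergmProb]
  rw [← Finset.sum_div, div_self (sum_exp_hamiltonian_pos V G β n).ne']

lemma rate_mul_ergmProb (n : ℕ) (e : EdgeSet n) (x : Config n) :
    rate V G β n e x * (ergmProb V G β (Function.update x e true)
      + ergmProb V G β (Function.update x e false))
        = ergmProb V G β (Function.update x e true) := by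
  have hZ := (sum_exp_hamiltonian_pos V G β n).ne'
  rw [rate, Phi, dHam, ergmProb, ergmProb, Real.exp_sub]
  have h1 := Real.exp_pos (Hamiltonian V G β (Function.update x e true))
  have h2 := Real.exp_pos (Hamiltonian V G β (Function.update x e false))
  field_simp
  ring

lemma sum_ergmProb_mul_glauber_pow {n : ℕ} [Nonempty (EdgeSet n)] (t : ℕ) (f : Config n → ℝ) :
    ∑ x, ergmProb V G β x * ((glauber (rate V G β n)) ^ t) f x = ∑ x, ergmProb V G β x * f x :=
  sum_mul_glauber_pow (rate_update V G β n) (rate_mul_ergmProb V G β n) t f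

end Rate

section GrandCoupling

instance (n : ℕ) : DiscreteMeasurableSpace (EdgeSet n) := ⟨fun _ => trivial⟩

instance (n : ℕ) [Nonempty (EdgeSet n)] : IsProbabilityMeasure
    ((Fintype.card (EdgeSet n) : ℝ≥0∞)⁻¹ • (Measure.count : Measure (EdgeSet n))) := by
  refine ⟨?_⟩
  rw [Measure.smul_apply, Measure.count_univ, smul_eq_mul, ENat.card_eq_coe_fintype_card]
  refine ENNReal.inv_mul_cancel ?_ (by simp)
  exact_mod_cast Fintype.card_ne_zero

instance : IsProbabilityMeasure (volume.restrict (Set.Ioc (0 : ℝ) 1)) :=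
  ⟨by simp⟩

instance (n : ℕ) [Nonempty (EdgeSet n)] : IsProbabilityMeasure (seed n) := by
  unfold seed; infer_instance

instance (n t : ℕ) [Nonempty (EdgeSet n)] : IsProbabilityMeasure (seeds n t) := by
  unfold seeds; infer_instance

variable {n s : ℕ} (V : Fin s → ℕ) (G : ∀ i, SimpleGraph (Fin (V i))) (β : Fin s → ℝ)

lemma measurable_gcStep :
    Measurable fun z : (EdgeSet n × ℝ) × Config n => gcStep V G β z.1 z.2 := by
  refine measurable_from_prod_countable_left fun x => ?_
  refine measurable_from_prod_countable_right fun e => ?_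
  have h : Measurable fun u : ℝ => if u ≤ Phi (dHam V G β e x) then true else false :=
    Measurable.ite measurableSet_Iic measurable_const measurable_const
  exact (measurable_of_finite (Function.update x e)).comp h

lemma measurable_gcRun (t : ℕ) (x : Config n) :
    Measurable fun ω : Fin t → EdgeSet n × ℝ => gcRun V G β t ω x := by
  induction t with
  | zero => exact measurable_const
  | succ t ih =>
    have h : Measurable fun ω : Fin (t + 1) → EdgeSet n × ℝ => fun i : Fin t => ω i.castSucc :=
      measurable_pi_lambda _ fun i => measurable_pi_apply _
    exact (measurable_gcStep V G β).comp ((measurable_pi_apply (Fin.last t)).prodMk (ih.comp h))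

lemma integrable_comp_config {Ω : Type*} [MeasurableSpace Ω] {μ : Measure Ω} [IsFiniteMeasure μ]
    (f : Config n → ℝ) {X : Ω → Config n} (hX : Measurable X) :
    Integrable (fun ω => f (X ω)) μ :=
  Integrable.of_bound ((measurable_of_finite f).comp hX).aestronglyMeasurable
    (∑ x, ‖f x‖) (Eventually.of_forall fun _ =>
      Finset.single_le_sum (f := fun x => ‖f x‖) (fun _ _ => norm_nonneg _) (Finset.mem_univ _))

lemma integral_unitInterval_ite {c : ℝ} (hc : c ∈ Set.Icc (0 : ℝ) 1) (a b : ℝ) :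
    ∫ u in Set.Ioc (0 : ℝ) 1, (if u ≤ c then a else b) = c * a + (1 - c) * b := by
  have h : (fun u : ℝ => if u ≤ c then a else b)
      = fun u => (Set.Iic c).indicator (fun _ => a - b) u + b := by
    funext u
    by_cases hu : u ≤ c <;> simp [hu]
  rw [h, integral_add ((integrable_const _).indicator measurableSet_Iic) (integrable_const _),
    integral_indicator measurableSet_Iic, Measure.restrict_restrict measurableSet_Iic]
  have hset : Set.Iic c ∩ Set.Ioc (0 : ℝ) 1 = Set.Ioc 0 c := by
    ext u
    simp only [Set.mem_inter_iff, Set.mem_Iic, Set.mem_Ioc]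
    exact ⟨fun h => ⟨h.2.1, h.1⟩, fun h => ⟨h.2, h.1, h.2.trans hc.2⟩⟩
  rw [hset]
  simp [hc.1]
  ring

lemma integral_gcStep [Nonempty (EdgeSet n)] (f : Config n → ℝ) (x : Config n) :
    ∫ ω, f (gcStep V G β ω x) ∂(seed n) = glauber (rate V G β n) f x := by
  have hf : Integrable (fun ω => f (gcStep V G β ω x)) (seed n) :=
    integrable_comp_config f ((measurable_gcStep V G β).comp measurable_prodMk_right)
  rw [seed] at hf ⊢
  rw [integral_prod _ hf, integral_smul_measure, integral_count, glauber_apply]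
  simp only [ENNReal.toReal_inv, ENNReal.toReal_natCast, smul_eq_mul]
  congr 1
  refine Finset.sum_congr rfl fun e _ => ?_
  rw [← integral_unitInterval_ite (rate_mem_Icc V G β n e x)]
  refine integral_congr_ae (Eventually.of_forall fun u => ?_)
  rw [show rate V G β n e x = Phi (dHam V G β e x) from rfl]
  simp only [gcStep]
  by_cases hu : u ≤ Phi (dHam V G β e x)
  · simp only [if_pos hu]
  · simp only [if_neg hu]

lemma integral_gcRun [Nonempty (EdgeSet n)] (t : ℕ) (f : Config n → ℝ) (x : Config n) :
    ∫ ω, f (gcRun V G β t ω x) ∂(seeds n t) = ((glauber (rate V G β n)) ^ t) f x := by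
  induction t generalizing f with
  | zero => simp [gcRun]
  | succ t ih =>
    have hmp := measurePreserving_piFinSuccAbove (fun _ : Fin (t + 1) => seed n) (Fin.last t)
    have hX : Measurable fun z : (EdgeSet n × ℝ) × (Fin t → EdgeSet n × ℝ) =>
        gcStep V G β z.1 (gcRun V G β t z.2 x) :=
      (measurable_gcStep V G β).comp
        (measurable_fst.prodMk ((measurable_gcRun V G β t x).comp measurable_snd))
    have h := hmp.integral_comp' fun z : (EdgeSet n × ℝ) × (Fin t → EdgeSet n × ℝ) =>
      f (gcStep V G β z.1 (gcRun V G β t z.2 x))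
    rw [integral_prod_symm _ (integrable_comp_config f hX)] at h
    simp only [integral_gcStep] at h
    rw [pow_succ, Module.End.mul_apply, ← ih]
    refine Eq.trans ?_ h
    refine integral_congr_ae (Eventually.of_forall fun ω => ?_)
    simp only [gcRun]
    congr 3
    funext i
    simp [MeasurableEquiv.piFinSuccAbove, Fin.init]

variable {β} in
lemma gcStep_mono (hβ : ∀ i, 0 < β i) (ω : EdgeSet n × ℝ) : Monotone (gcStep V G β ω) := by
  intro x y h
  have hP := rate_mono V G hβ n ω.1 h
  simp only [rate] at hP
  rw [gcStep, gcStep, update_le_update_iff]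
  refine ⟨?_, fun e _ => h e⟩
  split_ifs with h1 h2
  · exact le_rfl
  · exact absurd (h1.trans hP) h2
  · exact Bool.false_le _
  · exact le_rfl

variable {β} in
lemma gcRun_mono (hβ : ∀ i, 0 < β i) (t : ℕ) (ω : Fin t → EdgeSet n × ℝ) :
    Monotone (gcRun V G β t ω) := by
  induction t with
  | zero => exact monotone_id
  | succ t ih => exact (gcStep_mono V G hβ _).comp (ih _)

end GrandCoupling

section BurnIn

lemma mul_one_sub_div_pow_le {γ a M : ℝ} {n T : ℕ} (hγ0 : 0 ≤ γ) (hγ1 : γ ≤ 1) (hn : 1 ≤ n)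
    (hM1 : 1 ≤ M) (hMn : M ≤ (n : ℝ) ^ 2) (hT : a * (n : ℝ) ^ 3 - 1 ≤ T) :
    M * (1 - γ / M) ^ T ≤ 3 * (n : ℝ) ^ 2 * Real.exp (-(γ * a * n)) := by
  have hn1 : (1 : ℝ) ≤ n := by exact_mod_cast hn
  have hM0 : 0 < M := by linarith
  have h0 : 0 ≤ 1 - γ / M := by
    rw [sub_nonneg, div_le_one hM0]
    linarith
  have hTn : a * n - 1 ≤ T / (n : ℝ) ^ 2 := by
    rw [le_div_iff₀ (by positivity)]
    nlinarith [sq_nonneg ((n : ℝ) - 1)]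
  have hTM : (T : ℝ) / (n : ℝ) ^ 2 ≤ T / M := by gcongr
  have h1 : (1 - γ / M) ^ T ≤ 3 * Real.exp (-(γ * a * n)) := by
    calc (1 - γ / M) ^ T ≤ Real.exp (-(γ / M)) ^ T :=
          pow_le_pow_left₀ h0 (Real.one_sub_le_exp_neg _) _
      _ = Real.exp (-(γ * (T / M))) := by
          rw [← Real.exp_nat_mul]; congr 1; ring
      _ ≤ Real.exp (1 + -(γ * a * n)) := by
          refine Real.exp_le_exp.2 ?_
          have := mul_le_mul_of_nonneg_left (hTn.trans hTM) hγ0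
          linarith
      _ ≤ 3 * Real.exp (-(γ * a * n)) := by
          rw [Real.exp_add]
          gcongr
          linarith [Real.exp_one_lt_d9]
  calc M * (1 - γ / M) ^ T ≤ (n : ℝ) ^ 2 * (3 * Real.exp (-(γ * a * n))) := by gcongr
    _ = _ := by ring

lemma nonempty_edgeSet {n : ℕ} (hn : 2 ≤ n) : Nonempty (EdgeSet n) := by
  rw [← Fintype.card_pos_iff, card_edgeSet]
  exact Nat.choose_pos hn

lemma one_le_card_edgeSet {n : ℕ} (hn : 2 ≤ n) : (1 : ℝ) ≤ Fintype.card (EdgeSet n) := by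
  rw [card_edgeSet]
  exact_mod_cast Nat.choose_pos hn

lemma card_edgeSet_le_sq (n : ℕ) : (Fintype.card (EdgeSet n) : ℝ) ≤ (n : ℝ) ^ 2 := by
  rw [card_edgeSet]
  exact_mod_cast Nat.choose_le_pow n 2

variable {s : ℕ} (V : Fin s → ℕ) (G : ∀ i, SimpleGraph (Fin (V i))) (β : Fin s → ℝ)

/-- The observables whose expectation at times of order `n ^ 3` is exponentially small in `n`,
uniformly in the initial state. -/
def Rare (f : ∀ n, Config n → ℝ) : Prop :=
  ∀ θ : ℝ, 0 < θ → ∃ c : ℝ, 0 < c ∧ ∀ᶠ n : ℕ in atTop, ∀ t : ℕ, θ * (n : ℝ) ^ 3 ≤ t →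
    (t : ℝ) ≤ 2 * (n : ℝ) ^ 3 → ∀ x,
      ((glauber (rate V G β n)) ^ t) (f n) x ≤ Real.exp (-(c * n))

variable {V G β}

lemma Rare.mono {f g : ∀ n, Config n → ℝ} (hf : Rare V G β f) (h : ∀ n x, g n x ≤ f n x) :
    Rare V G β g := by
  intro θ hθ
  obtain ⟨c, hc, hn⟩ := hf θ hθ
  refine ⟨c, hc, ?_⟩
  filter_upwards [hn] with n hn t h1 h2 x
  exact (glauber_pow_mono (rate_mem_Icc V G β n) t (h n) x).trans (hn t h1 h2 x)

/-- If the rates rarely exceed `q` then a monotone observable that is exponentially small under the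
product Bernoulli weight with parameter `q` is rare. -/
lemma Rare.of_bernMean {σ q : ℝ} (hσ : σ = 1 ∨ σ = -1) (hq : q ∈ Set.Icc (0 : ℝ) 1)
    (hlevel : Rare V G β fun n => exceed σ (rate V G β n) q) {f : ∀ n, Config n → ℝ}
    (hf : ∀ n x, f n x ∈ Set.Icc (0 : ℝ) 1) (hfσ : ∀ n, SignedMono σ (f n))
    (hmean : ∃ c : ℝ, 0 < c ∧ ∀ᶠ n : ℕ in atTop, bernMean q (f n) ≤ Real.exp (-(c * n))) :
    Rare V G β f := by
  intro θ hθ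
  obtain ⟨c₁, hc₁, h₁⟩ := hlevel (θ / 2) (half_pos hθ)
  obtain ⟨c₂, hc₂, h₂⟩ := hmean
  set c := min (min c₁ c₂) (θ / 2) with hc
  have hcpos : 0 < c := lt_min (lt_min hc₁ hc₂) (half_pos hθ)
  have hcc₁ : c ≤ c₁ := (min_le_left _ _).trans (min_le_left _ _)
  have hcc₂ : c ≤ c₂ := (min_le_left _ _).trans (min_le_right _ _)
  have hcθ : c ≤ θ / 2 := min_le_right _ _
  refine ⟨c / 2, half_pos hcpos, ?_⟩
  filter_upwards [h₁, h₂, eventually_mul_pow_mul_exp_le 6 hcpos 3, eventually_ge_atTop 2]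
    with n h₁ h₂ hpoly hn t ht₁ ht₂ x
  have : Nonempty (EdgeSet n) := nonempty_edgeSet hn
  have hn1 : (1 : ℝ) ≤ n := by exact_mod_cast (one_le_two.trans hn)
  have hexp : ∀ {b : ℝ}, c ≤ b → Real.exp (-(b * n)) ≤ Real.exp (-(c * n)) := fun {b} hb =>
    Real.exp_le_exp.2 (by nlinarith)
  have hE := Real.exp_nonneg (-(c * n))
  set T := ⌊θ / 2 * (n : ℝ) ^ 3⌋₊ with hT
  have hTle : (T : ℝ) ≤ θ / 2 * (n : ℝ) ^ 3 := Nat.floor_le (by positivity)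
  have hTlt : θ / 2 * (n : ℝ) ^ 3 < T + 1 := Nat.lt_floor_add_one _
  have hn3 : (0 : ℝ) < (n : ℝ) ^ 3 := by positivity
  have hTt : T ≤ t := by
    have : (T : ℝ) ≤ t := by nlinarith
    exact_mod_cast this
  have hsub : ((t - T : ℕ) : ℝ) = t - T := by push_cast [hTt]; ring
  have hB : ∀ r, t - T ≤ r → r ≤ t - T + T → ∀ x,
      ((glauber (rate V G β n)) ^ r) (exceed σ (rate V G β n) q) x ≤ Real.exp (-(c₁ * n)) := by
    intro r hr1 hr2
    rw [Nat.sub_add_cancel hTt] at hr2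
    have e1 : ((t - T : ℕ) : ℝ) ≤ r := by exact_mod_cast hr1
    have e2 : (r : ℝ) ≤ t := by exact_mod_cast hr2
    exact h₁ r (by linarith) (by linarith)
  have key := glauber_pow_add_le_bernMean (rate_mem_Icc V G β n) hσ hq
    (B := exceed σ (rate V G β n) q) (fun x => (exceed_mem_Icc _ _ _ x).1)
    (fun x hx e => by
      by_contra hcon
      rw [exceed, if_pos ⟨e, not_le.1 hcon⟩] at hx
      exact lt_irrefl _ hx) T hB (hf n) (hfσ n) x
  rw [Nat.sub_add_cancel hTt] at key
  have hM := mul_one_sub_div_pow_le (γ := 1) (a := θ / 2) (T := T) zero_le_one le_rfl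
    (one_le_two.trans hn) (one_le_card_edgeSet hn) (card_edgeSet_le_sq n) (by linarith)
  rw [one_div, one_mul] at hM
  refine key.trans (le_trans ?_ hpoly)
  have hn23 : (n : ℝ) ^ 2 ≤ (n : ℝ) ^ 3 := pow_le_pow_right₀ hn1 (by norm_num)
  have hn03 : (1 : ℝ) ≤ (n : ℝ) ^ 3 := one_le_pow₀ hn1
  have p1 : bernMean q (f n) ≤ (n : ℝ) ^ 3 * Real.exp (-(c * n)) :=
    (h₂.trans (hexp hcc₂)).trans (le_mul_of_one_le_left hE hn03)
  have p2 : 3 * (n : ℝ) ^ 2 * Real.exp (-(θ / 2 * n)) ≤ 3 * (n : ℝ) ^ 3 * Real.exp (-(c * n)) := by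
    have := hexp hcθ
    gcongr
  have p3 : T * Real.exp (-(c₁ * n)) ≤ 2 * (n : ℝ) ^ 3 * Real.exp (-(c * n)) := by
    have hT2 : (T : ℝ) ≤ 2 * (n : ℝ) ^ 3 := by
      have : (T : ℝ) ≤ t := by exact_mod_cast hTt
      linarith
    have := hexp hcc₁
    gcongr
  linarith

lemma exceed_anti {E : Type*} {σ q q' : ℝ} (F : E → (E → Bool) → ℝ) (h : σ * q ≤ σ * q')
    (x : E → Bool) : exceed σ F q' x ≤ exceed σ F q x := by
  by_cases h' : ∃ e, 0 < σ * (F e x - q')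
  · obtain ⟨e, he⟩ := h'
    rw [exceed, exceed, if_pos ⟨e, he⟩, if_pos ⟨e, by linarith⟩]
  · rw [exceed, if_neg h']
    exact (exceed_mem_Icc σ F q x).1

/-- A family of monotone observables with bounded influences and with mean bounded away from `m`
rarely passes `m`, as soon as the rates rarely pass `q`. -/
lemma rare_exceed {σ q : ℝ} (hσ : σ = 1 ∨ σ = -1) (hq : q ∈ Set.Icc (0 : ℝ) 1)
    (hlevel : Rare V G β fun n => exceed σ (rate V G β n) q)
    (F : ∀ n, EdgeSet n → Config n → ℝ) (hFmono : ∀ n e, Monotone (F n e)) {C : ℝ} (hC : 0 < C)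
    (hF : ∀ᶠ n : ℕ in atTop, ∀ e : EdgeSet n, ∃ k : EdgeSet n → ℝ,
      (∀ g x, |F n e (Function.update x g true) - F n e (Function.update x g false)| ≤ k g) ∧
        ∑ g, k g ^ 2 ≤ C / n)
    {mean : ℕ → ℝ} (hmean : ∀ n e, bernMean q (F n e) = mean n) {lim m : ℝ}
    (hlim : Tendsto mean atTop (nhds lim)) (hm : 0 < σ * (m - lim)) :
    Rare V G β fun n => exceed σ (F n) m :=
  Rare.of_bernMean hσ hq hlevel (fun _ => exceed_mem_Icc _ _ _)
    (fun n => signedMono_exceed hσ (hFmono n) m)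
    (exists_bernMean_exceed_le hq hσ F hC hF hmean hlim hm)

lemma exceed_rate_Phi {σ : ℝ} (hσ : σ = 1 ∨ σ = -1) (n : ℕ) (m : ℝ) :
    exceed σ (rate V G β n) (Phi m) = exceed σ (fun e : EdgeSet n => dHam V G β e) m := by
  funext x
  have : ∀ e, 0 < σ * (rate V G β n e x - Phi m) ↔ 0 < σ * (dHam V G β e x - m) := by
    intro e
    rw [rate]
    rcases hσ with rfl | rfl
    · simp only [one_mul, sub_pos]
      exact Phi_strictMono.lt_iff_lt
    · simp only [neg_one_mul, neg_sub, sub_pos]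
      exact Phi_strictMono.lt_iff_lt
  rw [exceed, exceed]
  congr 1
  exact propext (exists_congr this)

lemma Rare.level_step (hβ : ∀ i, 0 < β i) {σ q q' : ℝ} (hσ : σ = 1 ∨ σ = -1)
    (hq : q ∈ Set.Icc (0 : ℝ) 1) (hlevel : Rare V G β fun n => exceed σ (rate V G β n) q)
    (h : 0 < σ * (q' - phiFn V G β q)) : Rare V G β fun n => exceed σ (rate V G β n) q' := by
  have hσσ : σ * σ = 1 := by rcases hσ with rfl | rfl <;> norm_num
  obtain ⟨ε, hε, hle⟩ : ∃ ε : ℝ, 0 < ε ∧ σ * Phi (Psi V G β q + σ * ε) ≤ σ * q' := by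
    have hc : Tendsto (fun ε : ℝ => σ * Phi (Psi V G β q + σ * ε)) (nhdsWithin 0 (Set.Ioi 0))
        (nhds (σ * Phi (Psi V G β q + σ * 0))) := by
      refine Tendsto.mono_left (Continuous.tendsto ?_ 0) nhdsWithin_le_nhds
      have := continuous_Phi
      fun_prop
    have hlt : σ * Phi (Psi V G β q + σ * 0) < σ * q' := by
      rw [mul_zero, add_zero]
      have : phiFn V G β q = Phi (Psi V G β q) := rfl
      rw [this] at h
      linarith
    obtain ⟨ε, h1, h2⟩ := ((hc.eventually_lt_const hlt).and self_mem_nhdsWithin).exists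
    exact ⟨ε, h2, h1.le⟩
  obtain ⟨C, hC, hcod⟩ := exists_sum_codegree_sq_le V G hβ
  have hr : Rare V G β fun n =>
      exceed σ (fun e : EdgeSet n => dHam V G β e) (Psi V G β q + σ * ε) := by
    refine rare_exceed hσ hq hlevel (fun n e => dHam V G β e) (fun n e => dHam_mono V G hβ e) hC ?_
      (fun n e => bernMean_dHam V G β q e) (tendsto_meanLink V G β q) ?_
    · filter_upwards [hcod] with n hn e
      refine ⟨_, fun g x => ?_, hn e⟩
      rw [dHam_eq]
      exact abs_linkWeight_update_sub_le (copyWeight_nonneg V hβ n) e g x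
    · rw [add_sub_cancel_left, ← mul_assoc, hσσ, one_mul]
      exact hε
  refine hr.mono fun n x => ?_
  rw [← exceed_rate_Phi hσ]
  exact exceed_anti _ hle x

lemma rare_exceed_rate_one : Rare V G β fun n => exceed 1 (rate V G β n) 1 := by
  refine fun θ _ => ⟨1, one_pos, ?_⟩
  filter_upwards [eventually_ge_atTop 2] with n hn t _ _ x
  have : Nonempty (EdgeSet n) := nonempty_edgeSet hn
  refine (glauber_pow_le_of_le (rate_mem_Icc V G β n) t (r := 0) (fun y => ?_) x).trans
    (Real.exp_nonneg _)
  rw [exceed, if_neg]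
  rintro ⟨e, he⟩
  linarith [(rate_mem_Icc V G β n e y).2]

lemma rare_exceed_rate_zero : Rare V G β fun n => exceed (-1) (rate V G β n) 0 := by
  refine fun θ _ => ⟨1, one_pos, ?_⟩
  filter_upwards [eventually_ge_atTop 2] with n hn t _ _ x
  have : Nonempty (EdgeSet n) := nonempty_edgeSet hn
  refine (glauber_pow_le_of_le (rate_mem_Icc V G β n) t (r := 0) (fun y => ?_) x).trans
    (Real.exp_nonneg _)
  rw [exceed, if_neg]
  rintro ⟨e, he⟩
  linarith [(rate_mem_Icc V G β n e y).1]

lemma continuous_phiFn : Continuous (phiFn V G β) :=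
  continuous_Phi.comp
    (continuous_iff_continuousAt.2 fun q => (hasDerivAt_Psi V G β q).continuousAt)

lemma phiFn_mem_Ioo (q : ℝ) : phiFn V G β q ∈ Set.Ioo (0 : ℝ) 1 := Phi_mem_Ioo _

lemma Subcritical.mem_Ioo {p : ℝ} (hsub : Subcritical V G β p) : p ∈ Set.Ioo (0 : ℝ) 1 :=
  hsub.1 ▸ phiFn_mem_Ioo p

/-- Uniqueness of the fixed point determines the sign of `phiFn q - q` on the unit interval. -/
lemma Subcritical.phiFn_lt {p : ℝ} (hsub : Subcritical V G β p) {σ q : ℝ}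
    (hσ : σ = 1 ∨ σ = -1) (hq : q ∈ Set.Icc (0 : ℝ) 1) (h : 0 < σ * (q - p)) :
    σ * phiFn V G β q < σ * q := by
  have hcont : Continuous fun u => phiFn V G β u - u := continuous_phiFn.sub continuous_id
  by_contra hcon
  rcases hσ with rfl | rfl
  · have hmem : (0 : ℝ) ∈ Set.Icc (phiFn V G β 1 - 1) (phiFn V G β q - q) :=
      ⟨by linarith [(phiFn_mem_Ioo (V := V) (G := G) (β := β) 1).2], by linarith⟩
    obtain ⟨u, hu, hu0⟩ := intermediate_value_Icc' hq.2 hcont.continuousOn hmem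
    have := hsub.2.1 u (by linarith)
    linarith [hu.1]
  · have hmem : (0 : ℝ) ∈ Set.Icc (phiFn V G β q - q) (phiFn V G β 0 - 0) :=
      ⟨by linarith, by linarith [(phiFn_mem_Ioo (V := V) (G := G) (β := β) 0).1]⟩
    obtain ⟨u, hu, hu0⟩ := intermediate_value_Icc' hq.1 hcont.continuousOn hmem
    have := hsub.2.1 u (by linarith)
    linarith [hu.2]

/-- Burn-in: after a time of order `n ^ 3` the rates are close to the fixed point. -/
lemma Subcritical.rare_exceed_rate {p : ℝ} (hsub : Subcritical V G β p) (hβ : ∀ i, 0 < β i)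
    {σ q : ℝ} (hσ : σ = 1 ∨ σ = -1) (h : 0 < σ * (q - p)) :
    Rare V G β fun n => exceed σ (rate V G β n) q := by
  have hσσ : σ * σ = 1 := by rcases hσ with rfl | rfl <;> norm_num
  have hcancel : ∀ u : ℝ, σ * (σ * u) = u := fun u => by rw [← mul_assoc, hσσ, one_mul]
  set A : Set ℝ := {u | σ * u ∈ Set.Icc (0 : ℝ) 1 ∧
    Rare V G β fun n => exceed σ (rate V G β n) (σ * u)} with hA
  have hAne : A.Nonempty := by
    rcases hσ with rfl | rfl
    · exact ⟨1, by simp, by simpa using rare_exceed_rate_one⟩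
    · exact ⟨0, by simp, by simpa using rare_exceed_rate_zero⟩
  have hAbdd : BddBelow A := by
    refine ⟨-1, fun u hu => ?_⟩
    rcases hσ with rfl | rfl
    · linarith [hu.1.1]
    · linarith [hu.1.2]
  have hp := hsub.mem_Ioo
  have hinf : sInf A ≤ σ * p := by
    by_contra hcon
    rw [not_le] at hcon
    set u := sInf A with hu
    have hclosed : IsClosed {v : ℝ | σ * v ∈ Set.Icc (0 : ℝ) 1} :=
      isClosed_Icc.preimage (continuous_const.mul continuous_id)
    have hu01 : σ * u ∈ Set.Icc (0 : ℝ) 1 :=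
      hclosed.closure_subset_iff.2 (fun v hv => hv.1) (csInf_mem_closure hAne hAbdd)
    have hlt := hsub.phiFn_lt hσ hu01 (by rw [mul_sub, hcancel]; linarith)
    rw [hcancel] at hlt
    obtain ⟨v, hv1, hv2⟩ := exists_between (max_lt hlt hcon)
    have hcont : Continuous fun w => σ * phiFn V G β (σ * w) := by
      have := continuous_phiFn (V := V) (G := G) (β := β)
      fun_prop
    have hev := (hcont.tendsto u).eventually_lt_const ((le_max_left _ _).trans_lt hv1)
    obtain ⟨ε, hε, hball⟩ := Metric.eventually_nhds_iff.1 hev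
    obtain ⟨w, hwA, hw⟩ := exists_lt_of_csInf_lt hAne (lt_add_of_pos_right u hε)
    have hwu : u ≤ w := csInf_le hAbdd hwA
    have hφw := hball (y := w) (by rw [Real.dist_eq, abs_lt]; constructor <;> linarith)
    have hvp : σ * p < v := (le_max_right _ _).trans_lt hv1
    have hvA : v ∈ A := by
      refine ⟨?_, hwA.2.level_step hβ hσ hwA.1 (by rw [mul_sub, hcancel]; linarith)⟩
      rcases hσ with rfl | rfl
      · exact ⟨by linarith [hp.1], by linarith [hu01.2]⟩
      · exact ⟨by linarith [hu01.1], by linarith [hp.2]⟩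
    linarith [csInf_le hAbdd hvA]
  obtain ⟨w, hwA, hw⟩ := exists_lt_of_csInf_lt hAne (show sInf A < σ * q by linarith)
  refine hwA.2.mono fun n x => exceed_anti _ ?_ x
  rw [hcancel]
  exact hw.le

lemma Subcritical.rare_exceed_pairWeight {p : ℝ} (hsub : Subcritical V G β p)
    (hβ : ∀ i, 0 < β i) {m : ℝ} (hm : psiDeriv V G β p < m) :
    Rare V G β fun n => exceed 1 (pairWeight (copyWeight V β n) (copySupport V G n)) m := by
  have hp := hsub.mem_Ioo
  obtain ⟨q, ⟨hqm, hq1⟩, hpq⟩ : ∃ q, (psiDeriv V G β q < m ∧ q < 1) ∧ p < q :=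
    (((((continuous_psiDeriv V G β).tendsto p).eventually_lt_const hm).and
      (eventually_lt_nhds hp.2)).filter_mono nhdsWithin_le_nhds |>.and
        (self_mem_nhdsWithin (s := Set.Ioi p))).exists
  obtain ⟨C, hC, hcod⟩ := exists_sum_codegree_sq_le V G hβ
  set D := ∑ i, numEdges (G i)
  refine rare_exceed (Or.inl rfl) (q := q) ⟨by linarith [hp.1], hq1.le⟩
    (hsub.rare_exceed_rate hβ (Or.inl rfl) (by linarith))
    (fun n e => pairWeight (copyWeight V β n) (copySupport V G n) e)
    (fun n e => pairWeight_mono (copyWeight_nonneg V hβ n) e) (C := (D : ℝ) ^ 2 * C + 1)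
    (by positivity) ?_ (fun n e => bernMean_pair V G β q e) (tendsto_meanPair V G β q)
    (by linarith)
  filter_upwards [hcod] with n hn e
  refine ⟨_, fun g x => abs_pairWeight_update_sub_le (copyWeight_nonneg V hβ n)
    (card_copySupport_le V G n) e g x, ?_⟩
  simp only [mul_pow]
  rw [← Finset.mul_sum]
  refine (mul_le_mul_of_nonneg_left (hn e) (sq_nonneg _)).trans ?_
  rw [← mul_div_assoc]
  gcongr
  linarith

end BurnIn

section EdgeCount

lemma ite_true_mono {a b : Bool} (h : a ≤ b) :
    (if a = true then (1 : ℝ) else 0) ≤ if b = true then 1 else 0 := by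
  cases a <;> cases b
  · simp
  · simp
  · exact absurd h (by decide)
  · simp

variable {E : Type*} [Fintype E]

/-- The number of coordinates equal to `true`. -/
def edgeCount (x : E → Bool) : ℝ := ∑ e, if x e = true then 1 else 0

lemma edgeCount_mono : Monotone (edgeCount : (E → Bool) → ℝ) := by
  intro x y h
  exact Finset.sum_le_sum fun e _ => ite_true_mono (h e)

lemma one_le_edgeCount_sub {x y : E → Bool} (h : x ≤ y) (hne : x ≠ y) :
    1 ≤ edgeCount y - edgeCount x := by
  obtain ⟨e, he⟩ := Function.ne_iff.1 hne
  have hmono : ∀ f, (0 : ℝ) ≤ (if y f = true then 1 else 0) - if x f = true then 1 else 0 :=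
    fun f => sub_nonneg.2 (ite_true_mono (h f))
  rw [edgeCount, edgeCount, ← Finset.sum_sub_distrib]
  refine le_trans ?_ (Finset.single_le_sum (fun f _ => hmono f) (Finset.mem_univ e))
  have hle : x e ≤ y e := h e
  generalize x e = a at *
  generalize y e = b at *
  cases a <;> cases b
  · exact absurd rfl he
  · simp
  · exact absurd hle (by decide)
  · exact absurd rfl he

lemma edgeCount_nonneg (x : E → Bool) : 0 ≤ edgeCount x :=
  Finset.sum_nonneg fun e _ => by split_ifs <;> norm_num

lemma edgeCount_le_card (x : E → Bool) : edgeCount x ≤ Fintype.card E := by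
  refine (Finset.sum_le_card_nsmul _ _ 1 fun e _ => ?_).trans ?_
  · split_ifs <;> norm_num
  · simp

variable [DecidableEq E]

lemma edgeCount_update (x : E → Bool) (e : E) (b : Bool) :
    edgeCount (Function.update x e b)
      = edgeCount x - (if x e = true then 1 else 0) + if b = true then 1 else 0 := by
  rw [edgeCount, edgeCount, ← Finset.add_sum_erase _ _ (Finset.mem_univ e),
    ← Finset.add_sum_erase _ (fun f => if x f = true then (1 : ℝ) else 0) (Finset.mem_univ e),
    Finset.sum_congr rfl fun f hf => by
      rw [Function.update_of_ne (Finset.ne_of_mem_erase hf)], Function.update_self]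
  ring

lemma glauber_edgeCount [Nonempty E] (c : E → (E → Bool) → ℝ) (x : E → Bool) :
    glauber c edgeCount x
      = (1 - (Fintype.card E : ℝ)⁻¹) * edgeCount x + (Fintype.card E : ℝ)⁻¹ * ∑ e, c e x := by
  have hM : (Fintype.card E : ℝ) ≠ 0 := by exact_mod_cast Fintype.card_ne_zero
  have h : ∀ e, c e x * edgeCount (Function.update x e true)
      + (1 - c e x) * edgeCount (Function.update x e false)
      = edgeCount x - (if x e = true then 1 else 0) + c e x := by
    intro e
    rw [edgeCount_update, edgeCount_update]
    simp only [if_true, Bool.false_eq_true, if_false]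
    ring
  rw [glauber_apply, Finset.sum_congr rfl fun e _ => h e, Finset.sum_add_distrib,
    Finset.sum_sub_distrib, Finset.sum_const, Finset.card_univ, nsmul_eq_mul]
  rw [show ∑ e, (if x e = true then (1 : ℝ) else 0) = edgeCount x from rfl]
  field_simp

/-- A bound for the sum of the rate differences by `κ` times the Hamming distance gives a
contraction of the Hamming distance in one step of the dynamics. -/
lemma glauber_edgeCount_sub_le [Nonempty E] {c : E → (E → Bool) → ℝ} {κ b : ℝ} {x y : E → Bool}
    (hb : ∑ e, (c e y - c e x) ≤ κ * (edgeCount y - edgeCount x) + Fintype.card E * b) :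
    glauber c edgeCount y - glauber c edgeCount x
      ≤ (1 - (1 - κ) / Fintype.card E) * (edgeCount y - edgeCount x) + b := by
  have hM : (0 : ℝ) < Fintype.card E := by exact_mod_cast Fintype.card_pos
  rw [glauber_edgeCount, glauber_edgeCount]
  rw [Finset.sum_sub_distrib] at hb
  have := mul_le_mul_of_nonneg_left hb (inv_nonneg.2 hM.le)
  rw [mul_add, inv_mul_cancel_left₀ hM.ne'] at this
  rw [div_eq_mul_inv]
  linarith

end EdgeCount

section Coupling

variable {s : ℕ} {V : Fin s → ℕ} {G : ∀ i, SimpleGraph (Fin (V i))} {β : Fin s → ℝ}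

/-- One-step contraction of the Hamming distance between two ordered states whose rates are close
to `p`. -/
lemma sum_rate_sub_le (hβ : ∀ i, 0 < β i) {n : ℕ} {x y : Config n} (hxy : x ≤ y)
    {u l m : ℝ} (hu : ∀ e, rate V G β n e y ≤ u) (hl : ∀ e, l ≤ rate V G β n e x) (hl1 : l ≤ 1)
    (hu0 : 0 ≤ u)
    (hm : ∀ e, pairWeight (copyWeight V β n) (copySupport V G n) e y ≤ m) :
    ∑ e, (rate V G β n e y - rate V G β n e x)
      ≤ u * (1 - l) * m * (edgeCount y - edgeCount x) := by
  have hul : 0 ≤ u * (1 - l) := mul_nonneg hu0 (by linarith)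
  have h1 : ∀ e, rate V G β n e y - rate V G β n e x
      ≤ u * (1 - l) * (dHam V G β e y - dHam V G β e x) := by
    intro e
    refine (Phi_sub_le _ _).trans ?_
    have := dHam_mono V G hβ e hxy
    refine mul_le_mul_of_nonneg_right ?_ (by linarith)
    exact mul_le_mul (hu e) (sub_le_sub_left (hl e) 1)
      (sub_nonneg.2 (rate_mem_Icc V G β n e x).2) hu0
  refine (Finset.sum_le_sum fun e _ => h1 e).trans ?_
  rw [← Finset.mul_sum, mul_assoc _ m]
  refine mul_le_mul_of_nonneg_left ?_ hul
  simp only [dHam_eq]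
  refine (sum_linkWeight_sub_le (copyWeight_nonneg V hβ n) hxy).trans ?_
  rw [mul_comm m, edgeCount, edgeCount, ← Finset.sum_sub_distrib, Finset.sum_mul]
  exact Finset.sum_le_sum fun f _ =>
    mul_le_mul_of_nonneg_left (hm f) (sub_nonneg.2 (ite_true_mono (hxy f)))

variable (V G β) in
/-- The expected Hamming distance between the chains started from the full and from the empty
configuration under the monotone coupling. -/
noncomputable def gap (n t : ℕ) : ℝ :=
  ((glauber (rate V G β n)) ^ t) edgeCount (fun _ => true)
    - ((glauber (rate V G β n)) ^ t) edgeCount (fun _ => false)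

lemma integrable_gcRun {n t : ℕ} [Nonempty (EdgeSet n)] (f : Config n → ℝ) (x : Config n) :
    Integrable (fun ω => f (gcRun V G β t ω x)) (seeds n t) :=
  integrable_comp_config f (measurable_gcRun V G β t x)

lemma gcRun_false_le (hβ : ∀ i, 0 < β i) {n t : ℕ} (ω : Fin t → EdgeSet n × ℝ) (x : Config n) :
    gcRun V G β t ω (fun _ => false) ≤ gcRun V G β t ω x :=
  gcRun_mono V G hβ t ω fun _ => Bool.false_le _

lemma le_gcRun_true (hβ : ∀ i, 0 < β i) {n t : ℕ} (ω : Fin t → EdgeSet n × ℝ) (x : Config n) :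
    gcRun V G β t ω x ≤ gcRun V G β t ω (fun _ => true) :=
  gcRun_mono V G hβ t ω fun _ => Bool.le_true _

lemma glauber_pow_monotone (hβ : ∀ i, 0 < β i) {n : ℕ} [Nonempty (EdgeSet n)] (t : ℕ)
    {f : Config n → ℝ} (hf : Monotone f) : Monotone (((glauber (rate V G β n)) ^ t) f) := by
  intro x y h
  rw [← integral_gcRun, ← integral_gcRun]
  exact integral_mono (integrable_gcRun f x) (integrable_gcRun f y)
    fun ω => hf (gcRun_mono V G hβ t ω h)

/-- The chains started from any two states meet as soon as the extremal chains do. -/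
lemma glauber_pow_sub_le (hβ : ∀ i, 0 < β i) {n : ℕ} [Nonempty (EdgeSet n)] (t : ℕ)
    {f : Config n → ℝ} {K : ℝ} (hK : ∀ u v, f u - f v ≤ K) (x y : Config n) :
    ((glauber (rate V G β n)) ^ t) f x - ((glauber (rate V G β n)) ^ t) f y
      ≤ K * gap V G β n t := by
  have hK0 : 0 ≤ K := by simpa using hK x x
  rw [gap, ← integral_gcRun, ← integral_gcRun, ← integral_gcRun, ← integral_gcRun,
    ← integral_sub (integrable_gcRun f x) (integrable_gcRun f y),
    ← integral_sub (integrable_gcRun _ _) (integrable_gcRun _ _), ← integral_const_mul]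
  refine integral_mono ((integrable_gcRun f x).sub (integrable_gcRun f y))
    (((integrable_gcRun _ _).sub (integrable_gcRun _ _)).const_mul _) fun ω => ?_
  have hle := (gcRun_false_le (V := V) (G := G) hβ ω x).trans (le_gcRun_true hβ ω x)
  by_cases h : gcRun V G β t ω (fun _ => false) = gcRun V G β t ω (fun _ => true)
  · have hx := le_antisymm ((le_gcRun_true hβ ω x).trans h.ge) (gcRun_false_le hβ ω x)
    have hy := le_antisymm ((le_gcRun_true hβ ω y).trans h.ge) (gcRun_false_le hβ ω y)
    simp only [hx, hy, h, sub_self, mul_zero, le_refl]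
  · exact (hK _ _).trans (le_mul_of_one_le_right hK0 (one_le_edgeCount_sub hle h))

lemma gap_nonneg (hβ : ∀ i, 0 < β i) (n t : ℕ) [Nonempty (EdgeSet n)] : 0 ≤ gap V G β n t :=
  sub_nonneg.2 (glauber_pow_monotone hβ t edgeCount_mono fun _ => Bool.false_le _)

lemma gap_le_card (n t : ℕ) [Nonempty (EdgeSet n)] :
    gap V G β n t ≤ Fintype.card (EdgeSet n) := by
  have h1 := glauber_pow_le_of_le (rate_mem_Icc V G β n) t edgeCount_le_card (fun _ => true)
  have h2 := le_glauber_pow_of_le (rate_mem_Icc V G β n) t edgeCount_nonneg (fun _ => false)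
  rw [gap]
  linarith

lemma gap_add_le (hβ : ∀ i, 0 < β i) (n a b : ℕ) [Nonempty (EdgeSet n)] :
    gap V G β n (a + b) ≤ gap V G β n a * gap V G β n b := by
  have hmono := glauber_pow_monotone (V := V) (G := G) hβ (n := n) b edgeCount_mono
  have h := glauber_pow_sub_le (V := V) (G := G) hβ a (K := gap V G β n b)
    (f := ((glauber (rate V G β n)) ^ b) edgeCount)
    (fun u v => sub_le_sub (hmono fun _ => Bool.le_true _) (hmono fun _ => Bool.false_le _))
    (fun _ => true) (fun _ => false)
  rw [mul_comm, gap, pow_add]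
  exact h

/-- Recursive bound for the expected Hamming distance, up to the probabilities of the events that
the states leave the region where the dynamics contracts. -/
lemma gap_succ_le (hβ : ∀ i, 0 < β i) {n : ℕ} [Nonempty (EdgeSet n)] {u l m : ℝ} (hu0 : 0 ≤ u)
    (hl1 : l ≤ 1) (hκ0 : 0 ≤ u * (1 - l) * m) (t : ℕ) :
    gap V G β n (t + 1) ≤ (1 - (1 - u * (1 - l) * m) / Fintype.card (EdgeSet n)) * gap V G β n t
      + (((glauber (rate V G β n)) ^ t) (exceed 1 (rate V G β n) u) (fun _ => true)
        + ((glauber (rate V G β n)) ^ t)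
            (exceed 1 (pairWeight (copyWeight V β n) (copySupport V G n)) m) (fun _ => true)
        + ((glauber (rate V G β n)) ^ t) (exceed (-1) (rate V G β n) l) (fun _ => false)) := by
  set κ := u * (1 - l) * m with hκ
  set B₁ := exceed 1 (rate V G β n) u
  set B₂ := exceed 1 (pairWeight (copyWeight V β n) (copySupport V G n)) m
  set B₃ := exceed (-1) (rate V G β n) l
  have hstep : ∀ x y : Config n, x ≤ y →
      glauber (rate V G β n) edgeCount y - glauber (rate V G β n) edgeCount x
        ≤ (1 - (1 - κ) / Fintype.card (EdgeSet n)) * (edgeCount y - edgeCount x)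
          + (B₁ y + B₂ y + B₃ x) := by
    intro x y hxy
    refine glauber_edgeCount_sub_le ?_
    have hM : (0 : ℝ) < Fintype.card (EdgeSet n) := by exact_mod_cast Fintype.card_pos
    have hd : 0 ≤ edgeCount y - edgeCount x := sub_nonneg.2 (edgeCount_mono hxy)
    have b1 := (exceed_mem_Icc 1 (rate V G β n) u y).1
    have b2 := (exceed_mem_Icc 1 (pairWeight (copyWeight V β n) (copySupport V G n)) m y).1
    have b3 := (exceed_mem_Icc (-1) (rate V G β n) l x).1
    by_cases hbad : 1 ≤ B₁ y + B₂ y + B₃ x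
    · have : ∑ e, (rate V G β n e y - rate V G β n e x) ≤ Fintype.card (EdgeSet n) := by
        refine (Finset.sum_le_card_nsmul _ _ 1 fun e _ => ?_).trans (by simp)
        linarith [(rate_mem_Icc V G β n e y).2, (rate_mem_Icc V G β n e x).1]
      have h1 : (Fintype.card (EdgeSet n) : ℝ) * 1
          ≤ Fintype.card (EdgeSet n) * (B₁ y + B₂ y + B₃ x) := by gcongr
      linarith [mul_nonneg hκ0 hd]
    · rw [not_le] at hbad
      have g1 : ∀ e, rate V G β n e y ≤ u := by
        by_contra hcon
        push Not at hcon
        obtain ⟨e, he⟩ := hcon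
        have : B₁ y = 1 := if_pos ⟨e, by linarith⟩
        linarith
      have g2 : ∀ e, pairWeight (copyWeight V β n) (copySupport V G n) e y ≤ m := by
        by_contra hcon
        push Not at hcon
        obtain ⟨e, he⟩ := hcon
        have : B₂ y = 1 := if_pos ⟨e, by linarith⟩
        linarith
      have g3 : ∀ e, l ≤ rate V G β n e x := by
        by_contra hcon
        push Not at hcon
        obtain ⟨e, he⟩ := hcon
        have : B₃ x = 1 := if_pos ⟨e, by linarith⟩
        linarith
      have := sum_rate_sub_le hβ hxy g1 g3 hl1 hu0 g2
      have : 0 ≤ (Fintype.card (EdgeSet n) : ℝ) * (B₁ y + B₂ y + B₃ x) := by positivity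
      linarith
  have i1 := fun f : Config n → ℝ =>
    integrable_gcRun (V := V) (G := G) (β := β) (t := t) f (fun _ => true)
  have i0 := fun f : Config n → ℝ =>
    integrable_gcRun (V := V) (G := G) (β := β) (t := t) f (fun _ => false)
  have hA : Integrable (fun ω => (1 - (1 - κ) / Fintype.card (EdgeSet n)) *
      (edgeCount (gcRun V G β t ω (fun _ => true))
        - edgeCount (gcRun V G β t ω (fun _ => false)))) (seeds n t) :=
    ((i1 _).sub (i0 _)).const_mul _
  have hB : Integrable (fun ω => B₁ (gcRun V G β t ω (fun _ => true))
      + B₂ (gcRun V G β t ω (fun _ => true)) + B₃ (gcRun V G β t ω (fun _ => false)))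
      (seeds n t) :=
    (i1 fun x => B₁ x + B₂ x).add (i0 _)
  rw [gap, gap, pow_succ, Module.End.mul_apply]
  simp only [← integral_gcRun]
  rw [← integral_sub (i1 _) (i0 _), ← integral_sub (i1 _) (i0 _), ← integral_const_mul,
    ← integral_add (i1 _) (i1 _), ← integral_add (i1 fun x => B₁ x + B₂ x) (i0 _),
    ← integral_add hA hB]
  exact integral_mono ((i1 _).sub (i0 _)) (hA.add hB)
    fun ω => hstep _ _ (gcRun_false_le hβ ω _)

end Coupling

section Decay

variable {s : ℕ} {V : Fin s → ℕ} {G : ∀ i, SimpleGraph (Fin (V i))} {β : Fin s → ℝ}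

lemma Subcritical.exists_contraction {p : ℝ} (hsub : Subcritical V G β p) (hβ : ∀ i, 0 < β i) :
    ∃ δ : ℝ, 0 < δ ∧ 0 ≤ (p + δ) * (1 - (p - δ)) * (psiDeriv V G β p + δ) ∧
      (p + δ) * (1 - (p - δ)) * (psiDeriv V G β p + δ) < 1 := by
  have hp := hsub.mem_Ioo
  have hψ : 0 ≤ psiDeriv V G β p := Finset.sum_nonneg fun i _ => by
    have := (hβ i).le
    have := hp.1.le
    positivity
  have hd : deriv (phiFn V G β) p = p * (1 - p) * psiDeriv V G β p := by
    have h1 : HasDerivAt (phiFn V G β) _ p :=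
      (Real.hasDerivAt_sigmoid (Psi V G β p)).comp p (hasDerivAt_Psi V G β p)
        |>.congr_of_eventuallyEq (Eventually.of_forall fun q => by simp [phiFn, Phi_eq_sigmoid])
    have h2 : Real.sigmoid (Psi V G β p) = p := by
      rw [← Phi_eq_sigmoid]; exact hsub.1
    rw [h1.deriv, h2]
  have hlt : p * (1 - p) * psiDeriv V G β p < 1 := hd ▸ hsub.2.2
  have hcont : Continuous fun δ : ℝ => (p + δ) * (1 - (p - δ)) * (psiDeriv V G β p + δ) := by
    fun_prop
  have hev : ∀ᶠ δ in nhdsWithin (0 : ℝ) (Set.Ioi 0),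
      (p + δ) * (1 - (p - δ)) * (psiDeriv V G β p + δ) < 1 := by
    refine (hcont.tendsto 0).mono_left nhdsWithin_le_nhds |>.eventually_lt_const ?_
    simpa using hlt
  obtain ⟨δ, h1, h2 : 0 < δ⟩ := (hev.and self_mem_nhdsWithin).exists
  refine ⟨δ, h2, ?_, h1⟩
  have := hp.1
  have := hp.2
  exact mul_nonneg (mul_nonneg (by linarith) (by linarith)) (by linarith)

lemma le_pow_mul_add_of_succ_le {g : ℕ → ℝ} {r b : ℝ} {a T : ℕ} (hr0 : 0 ≤ r) (hr1 : r ≤ 1)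
    (hb : 0 ≤ b) (h : ∀ t, a ≤ t → t < a + T → g (t + 1) ≤ r * g t + b) :
    g (a + T) ≤ r ^ T * g a + T * b := by
  induction T with
  | zero => simp
  | succ T ih =>
    have h1 := ih fun t h1 h2 => h t h1 (h2.trans (by omega))
    have h2 := h (a + T) (by omega) (by omega)
    have h3 := mul_le_mul_of_nonneg_left h1 hr0
    have h4 : r * (T * b) ≤ T * b := mul_le_of_le_one_left (by positivity) hr1
    rw [← add_assoc, pow_succ]
    push_cast
    linarith

lemma Subcritical.gap_le_exp {p : ℝ} (hsub : Subcritical V G β p) (hβ : ∀ i, 0 < β i) :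
    ∃ c : ℝ, 0 < c ∧ ∀ᶠ n : ℕ in atTop, ∀ t : ℕ, (n : ℝ) ^ 3 ≤ t → (t : ℝ) ≤ 2 * (n : ℝ) ^ 3 →
      gap V G β n t ≤ Real.exp (-(c * n)) := by
  obtain ⟨δ, hδ, hκ0, hκ1⟩ := hsub.exists_contraction hβ
  have hp := hsub.mem_Ioo
  obtain ⟨c₁, hc₁, h₁⟩ := hsub.rare_exceed_rate hβ (q := p + δ) (Or.inl rfl) (by linarith)
    (1 / 2) (by norm_num)
  obtain ⟨c₂, hc₂, h₂⟩ := hsub.rare_exceed_pairWeight hβ (m := psiDeriv V G β p + δ)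
    (by linarith) (1 / 2) (by norm_num)
  obtain ⟨c₃, hc₃, h₃⟩ := hsub.rare_exceed_rate hβ (q := p - δ) (Or.inr rfl) (by linarith)
    (1 / 2) (by norm_num)
  set κ := (p + δ) * (1 - (p - δ)) * (psiDeriv V G β p + δ) with hκ
  set c := min (min c₁ c₂) (min c₃ ((1 - κ) * (1 / 2))) with hc
  have hcpos : 0 < c := lt_min (lt_min hc₁ hc₂) (lt_min hc₃ (by linarith))
  have hcc₁ : c ≤ c₁ := (min_le_left _ _).trans (min_le_left _ _)
  have hcc₂ : c ≤ c₂ := (min_le_left _ _).trans (min_le_right _ _)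
  have hcc₃ : c ≤ c₃ := (min_le_right _ _).trans (min_le_left _ _)
  have hcκ : c ≤ (1 - κ) * (1 / 2) := (min_le_right _ _).trans (min_le_right _ _)
  refine ⟨c / 2, half_pos hcpos, ?_⟩
  filter_upwards [h₁, h₂, h₃, eventually_mul_pow_mul_exp_le 9 hcpos 3, eventually_ge_atTop 2]
    with n h₁ h₂ h₃ hpoly hn t ht₁ ht₂
  have : Nonempty (EdgeSet n) := nonempty_edgeSet hn
  have hn1 : (1 : ℝ) ≤ n := by exact_mod_cast (one_le_two.trans hn)
  have hexp : ∀ {b : ℝ}, c ≤ b → Real.exp (-(b * n)) ≤ Real.exp (-(c * n)) := fun {b} hb =>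
    Real.exp_le_exp.2 (by nlinarith)
  have hE := Real.exp_nonneg (-(c * n))
  set T := ⌊1 / 2 * (n : ℝ) ^ 3⌋₊ with hT
  have hTle : (T : ℝ) ≤ 1 / 2 * (n : ℝ) ^ 3 := Nat.floor_le (by positivity)
  have hTlt : 1 / 2 * (n : ℝ) ^ 3 < T + 1 := Nat.lt_floor_add_one _
  have hn3 : (0 : ℝ) < (n : ℝ) ^ 3 := by positivity
  have hTt : T ≤ t := by
    have : (T : ℝ) ≤ t := by linarith
    exact_mod_cast this
  have hsub' : ((t - T : ℕ) : ℝ) = t - T := by push_cast [hTt]; ring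
  have hM1 := one_le_card_edgeSet hn
  have hr0 : 0 ≤ 1 - (1 - κ) / Fintype.card (EdgeSet n) := by
    rw [sub_nonneg, div_le_one (by linarith)]
    linarith
  have hr1 : 1 - (1 - κ) / Fintype.card (EdgeSet n) ≤ 1 :=
    sub_le_self _ (div_nonneg (by linarith) (by linarith))
  have key := le_pow_mul_add_of_succ_le (g := gap V G β n) (a := t - T) (T := T)
    (b := 3 * Real.exp (-(c * n))) hr0 hr1 (by positivity) (by
      intro r hr1 hr2
      rw [Nat.sub_add_cancel hTt] at hr2
      have e1 : ((t - T : ℕ) : ℝ) ≤ r := by exact_mod_cast hr1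
      have e2 : (r : ℝ) ≤ t := by exact_mod_cast hr2.le
      have hr1' : 1 / 2 * (n : ℝ) ^ 3 ≤ r := by linarith
      have hr2' : (r : ℝ) ≤ 2 * (n : ℝ) ^ 3 := by linarith
      refine (gap_succ_le hβ (u := p + δ) (l := p - δ) (m := psiDeriv V G β p + δ)
        (by linarith [hp.1]) (by linarith [hp.2]) hκ0 r).trans ?_
      have b₁ := (h₁ r hr1' hr2' fun _ => true).trans (hexp hcc₁)
      have b₂ := (h₂ r hr1' hr2' fun _ => true).trans (hexp hcc₂)
      have b₃ := (h₃ r hr1' hr2' fun _ => false).trans (hexp hcc₃)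
      linarith)
  rw [Nat.sub_add_cancel hTt] at key
  have hM := mul_one_sub_div_pow_le (γ := 1 - κ) (a := 1 / 2) (T := T) (by linarith) (by linarith)
    (one_le_two.trans hn) hM1 (card_edgeSet_le_sq n) (by linarith)
  refine key.trans (le_trans ?_ hpoly)
  have hn23 : (n : ℝ) ^ 2 ≤ (n : ℝ) ^ 3 := pow_le_pow_right₀ hn1 (by norm_num)
  have p1 : (1 - (1 - κ) / Fintype.card (EdgeSet n)) ^ T * gap V G β n (t - T)
      ≤ 3 * (n : ℝ) ^ 3 * Real.exp (-(c * n)) := by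
    calc _ ≤ (1 - (1 - κ) / Fintype.card (EdgeSet n)) ^ T * Fintype.card (EdgeSet n) :=
          mul_le_mul_of_nonneg_left (gap_le_card n _) (pow_nonneg hr0 _)
      _ ≤ 3 * (n : ℝ) ^ 2 * Real.exp (-((1 - κ) * (1 / 2) * n)) := by rw [mul_comm]; exact hM
      _ ≤ _ := by
          have := hexp hcκ
          gcongr
  have p2 : T * (3 * Real.exp (-(c * n))) ≤ (n : ℝ) ^ 3 * (3 * Real.exp (-(c * n))) := by
    have : (T : ℝ) ≤ (n : ℝ) ^ 3 := by linarith
    gcongr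
  have : 0 ≤ (n : ℝ) ^ 3 * Real.exp (-(c * n)) := by positivity
  linarith

lemma Subcritical.exists_gap_le {p : ℝ} (hsub : Subcritical V G β p) (hβ : ∀ i, 0 < β i) :
    ∃ d : ℝ, 0 < d ∧ ∀ᶠ n : ℕ in atTop, ∀ t : ℕ, n ^ 3 ≤ t →
      gap V G β n t ≤ Real.exp (-d * (t : ℝ) / (n : ℝ) ^ 2) := by
  obtain ⟨c, hc, h⟩ := hsub.gap_le_exp hβ
  refine ⟨c / 2, half_pos hc, ?_⟩
  filter_upwards [h, eventually_ge_atTop 2] with n h hn t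
  have : Nonempty (EdgeSet n) := nonempty_edgeSet hn
  have hn0 : (0 : ℝ) < n := by exact_mod_cast (two_pos.trans_le hn)
  induction t using Nat.strong_induction_on with
  | _ t ih =>
    intro ht
    have ht' : (n : ℝ) ^ 3 ≤ t := by exact_mod_cast ht
    by_cases h2 : t ≤ 2 * n ^ 3
    · have h2' : (t : ℝ) ≤ 2 * (n : ℝ) ^ 3 := by exact_mod_cast h2
      refine (h t ht' h2').trans (Real.exp_le_exp.2 ?_)
      rw [le_div_iff₀ (by positivity)]
      nlinarith
    · have hn3 : 0 < n ^ 3 := by positivity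
      have h1 := ih (t - n ^ 3) (by omega) (by omega)
      have h3 := h (n ^ 3) (by push_cast; rfl) (by push_cast; linarith [pow_pos hn0 3])
      have h4 := gap_add_le (V := V) (G := G) hβ n (n ^ 3) (t - n ^ 3)
      rw [Nat.add_sub_cancel' ht] at h4
      refine h4.trans ((mul_le_mul h3 h1 (gap_nonneg hβ _ _) (Real.exp_nonneg _)).trans ?_)
      rw [← Real.exp_add]
      refine Real.exp_le_exp.2 ?_
      rw [Nat.cast_sub ht, Nat.cast_pow]
      have : -(c / 2) * ((t : ℝ) - (n : ℝ) ^ 3) / (n : ℝ) ^ 2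
          = -(c / 2) * (t : ℝ) / (n : ℝ) ^ 2 + c / 2 * n := by
        field_simp
        ring
      rw [this]
      nlinarith

variable (V G β) in
lemma toReal_lawFrom {n : ℕ} [Nonempty (EdgeSet n)] (t : ℕ) (x : Config n)
    (A : Set (Config n)) :
    (lawFrom V G β t x A).toReal
      = ((glauber (rate V G β n)) ^ t) (A.indicator fun _ => 1) x := by
  have hA : MeasurableSet A := A.toFinite.measurableSet
  have hm := measurable_gcRun V G β t x
  rw [← integral_gcRun, lawFrom, Measure.map_apply hm hA]
  have : (fun ω => A.indicator (fun _ => (1 : ℝ)) (gcRun V G β t ω x))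
      = ((fun ω => gcRun V G β t ω x) ⁻¹' A).indicator 1 := by
    rfl
  rw [this, integral_indicator_one (hm hA), measureReal_def]

variable (V G β) in
lemma toReal_ergmMeasure (n : ℕ) (A : Set (Config n)) :
    (ergmMeasure n V G β A).toReal
      = ∑ y, ergmProb V G β y * A.indicator (fun _ => 1) y := by
  have hA : MeasurableSet A := A.toFinite.measurableSet
  rw [ergmMeasure, withDensity_apply _ hA, ← lintegral_indicator hA, lintegral_count, tsum_fintype,
    ENNReal.toReal_sum]
  · refine Finset.sum_congr rfl fun y _ => ?_
    by_cases hy : y ∈ A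
    · simp [hy, ENNReal.toReal_ofReal (ergmProb_nonneg V G β y)]
    · simp [hy]
  · intro y _
    by_cases hy : y ∈ A <;> simp [hy]

lemma dTVmeas_lawFrom_le (hβ : ∀ i, 0 < β i) {n : ℕ} [Nonempty (EdgeSet n)] (t : ℕ)
    (x : Config n) : dTVmeas (lawFrom V G β t x) (ergmMeasure n V G β) ≤ gap V G β n t := by
  refine Real.iSup_le (fun A => ?_) (gap_nonneg hβ n t)
  set f : Config n → ℝ := A.indicator fun _ => 1 with hf
  have hK : ∀ u v, f u - f v ≤ 1 := fun u v => by
    have h1 : f u ≤ 1 := Set.indicator_le_self' (fun _ _ => zero_le_one) u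
    have h2 : 0 ≤ f v := Set.indicator_nonneg (fun _ _ => zero_le_one) v
    linarith
  have key := fun u v => glauber_pow_sub_le (V := V) (G := G) hβ t hK u v
  rw [toReal_lawFrom, toReal_ergmMeasure, ← sum_ergmProb_mul_glauber_pow V G β t]
  have hx : ((glauber (rate V G β n)) ^ t) f x
      = ∑ y : Config n, ergmProb V G β y * ((glauber (rate V G β n)) ^ t) f x := by
    rw [← Finset.sum_mul, sum_ergmProb, one_mul]
  rw [hx, ← Finset.sum_sub_distrib]
  refine (Finset.abs_sum_le_sum_abs _ _).trans ?_
  calc _ ≤ ∑ y : Config n, ergmProb V G β y * gap V G β n t := by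
        refine Finset.sum_le_sum fun y _ => ?_
        have h0 := ergmProb_nonneg V G β y
        rw [← mul_sub, abs_mul, abs_of_nonneg h0]
        refine mul_le_mul_of_nonneg_left (abs_sub_le_iff.2 ⟨?_, ?_⟩) h0
        · linarith [key x y]
        · linarith [key y x]
    _ = gap V G β n t := by rw [← Finset.sum_mul, sum_ergmProb, one_mul]

lemma seeds_gcRun_ne_le (hβ : ∀ i, 0 < β i) {n : ℕ} [Nonempty (EdgeSet n)] (t : ℕ) :
    (seeds n t {ω | gcRun V G β t ω (fun _ => true) ≠ gcRun V G β t ω (fun _ => false)}).toReal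
      ≤ gap V G β n t := by
  have hm : MeasurableSet
      {ω | gcRun V G β t ω (fun _ : EdgeSet n => true) ≠ gcRun V G β t ω (fun _ => false)} :=
    (measurableSet_eq_fun (measurable_gcRun V G β t _) (measurable_gcRun V G β t _)).compl
  rw [gap, ← integral_gcRun, ← integral_gcRun,
    ← integral_sub (integrable_gcRun _ _) (integrable_gcRun _ _)]
  refine (integral_indicator_one hm).symm.trans_le (integral_mono
    ((integrable_const 1).indicator hm) ((integrable_gcRun _ _).sub (integrable_gcRun _ _))
    fun ω => ?_)
  by_cases h : gcRun V G β t ω (fun _ => true) = gcRun V G β t ω (fun _ => false)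
  · simp [h]
  · simpa [h] using one_le_edgeCount_sub (gcRun_false_le (V := V) (G := G) hβ ω _) (Ne.symm h)

/-- The law of the monotone coupling of the chains started from the full and from the empty
configuration. -/
lemma exists_coupling (hβ : ∀ i, 0 < β i) {n : ℕ} [Nonempty (EdgeSet n)] (t : ℕ) :
    ∃ Γ : Measure (Config n × Config n), IsProbabilityMeasure Γ ∧
      Γ.map Prod.fst = lawFrom V G β t (fun _ => true) ∧
      Γ.map Prod.snd = lawFrom V G β t (fun _ => false) ∧
      (Γ {q : Config n × Config n | q.1 ≠ q.2}).toReal ≤ gap V G β n t := by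
  have h1 := measurable_gcRun V G β t (fun _ : EdgeSet n => true)
  have h0 := measurable_gcRun V G β t (fun _ : EdgeSet n => false)
  have h := h1.prodMk h0
  refine ⟨(seeds n t).map _, Measure.isProbabilityMeasure_map h.aemeasurable, ?_, ?_, ?_⟩
  · rw [Measure.map_map measurable_fst h]
    rfl
  · rw [Measure.map_map measurable_snd h]
    rfl
  · rw [Measure.map_apply h (Set.toFinite _).measurableSet]
    exact seeds_gcRun_ne_le hβ t

end Decay

/-- **(Equation (252): exponential coupling/mixing for `t ≥ n³`).**
If `β` is sub-critical, there is `d > 0` such that for all large `n` and all `t ≥ n³`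
there is a coupling of `Z^+(t)` and `Z^-(t)` with
`ℙ(Z^+(t) ≠ Z^-(t)) ≤ e^{-d t/n²}`; consequently, by monotonicity, for every initial
state `x`, `d_TV(law(Z^x(t)), π) ≤ e^{-d t/n²}`. -/
theorem exponential_mixing {s : ℕ} (V : Fin s → ℕ)
    (G : ∀ i, SimpleGraph (Fin (V i))) (β : Fin s → ℝ) (hβ : ∀ i, 0 < β i)
    (p : ℝ) (hsub : Subcritical V G β p) :
    ∃ d : ℝ, 0 < d ∧ ∃ N : ℕ, ∀ n : ℕ, N ≤ n → ∀ t : ℕ, n ^ 3 ≤ t →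
      (∃ Γ : Measure (Config n × Config n), IsProbabilityMeasure Γ ∧
        Γ.map Prod.fst = lawFrom V G β t (fun _ => true) ∧
        Γ.map Prod.snd = lawFrom V G β t (fun _ => false) ∧
        (Γ {q : Config n × Config n | q.1 ≠ q.2}).toReal ≤
          Real.exp (-d * (t : ℝ) / (n : ℝ) ^ 2)) ∧
      ∀ x : Config n,
        dTVmeas (lawFrom V G β t x) (ergmMeasure n V G β) ≤
          Real.exp (-d * (t : ℝ) / (n : ℝ) ^ 2) := by
  obtain ⟨d, hd, h⟩ := hsub.exists_gap_le hβ
  obtain ⟨N, hN⟩ := eventually_atTop.1 (h.and (eventually_ge_atTop 2))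
  refine ⟨d, hd, N, fun n hn t ht => ?_⟩
  obtain ⟨hgap, hn2⟩ := hN n hn
  have : Nonempty (EdgeSet n) := nonempty_edgeSet hn2
  obtain ⟨Γ, h1, h2, h3, h4⟩ := exists_coupling (V := V) (G := G) hβ (n := n) t
  exact ⟨⟨Γ, h1, h2, h3, h4.trans (hgap t ht)⟩,
    fun x => (dTVmeas_lawFrom_le hβ t x).trans (hgap t ht)⟩

end ERGM
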